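/- arXiv:2011.03662 — 6 statements merged into one kernel-verified Lean document; each statement's English description precedes it below -/
import Mathlib

section
/- Conserved quantities of the solvmanifold Type IIA ODE system: let λ > 0, let I ⊆ ℝ be an interval, and let α, β, γ, δ : I → ℝ be differentiable functions satisfying α' = 16λ²αβγ, β' = 16λ²αβδ, γ' = 16λ²αγδ, δ' = 16λ²βγδ on I. Then the function αδ − βγ is constant on I; moreover, if δ has no zeros on I then α/δ is constant on I, and if γ has no zeros on I then β/γ is constant on I. -/
/-- A function with vanishing derivative on an order-connected set of reals is constant there. -/
theorem Set.OrdConnected.eq_of_hasDerivAt_eq_zero {I : Set ℝ} (hI : I.OrdConnected) {f : ℝ → ℝ}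
    (hf : ∀ t ∈ I, HasDerivAt f 0 t) : ∀ s ∈ I, ∀ t ∈ I, f s = f t := by
  intro s hs t ht
  have h := hI.convex.norm_image_sub_le_of_norm_hasDerivWithin_le (C := 0)
    (fun x hx => (hf x hx).hasDerivWithinAt) (fun _ _ => norm_zero.le) ht hs
  rw [zero_mul] at h
  exact sub_eq_zero.mp (norm_le_zero_iff.mp h)

/-- Conserved quantities of the solvmanifold Type IIA ODE system
`α' = 16λ²αβγ, β' = 16λ²αβδ, γ' = 16λ²αγδ, δ' = 16λ²βγδ` on an interval `I`:
`αδ − βγ` is constant on `I`; if `δ` has no zeros on `I` then `α/δ` is constant on `I`,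
and if `γ` has no zeros on `I` then `β/γ` is constant on `I`. -/
theorem solvmanifold_flow_conserved_quantities (lam : ℝ) (hlam : 0 < lam)
    (I : Set ℝ) (hI : I.OrdConnected)
    (α β γ δ : ℝ → ℝ)
    (hα : ∀ t ∈ I, HasDerivAt α (16 * lam ^ 2 * α t * β t * γ t) t)
    (hβ : ∀ t ∈ I, HasDerivAt β (16 * lam ^ 2 * α t * β t * δ t) t)
    (hγ : ∀ t ∈ I, HasDerivAt γ (16 * lam ^ 2 * α t * γ t * δ t) t)
    (hδ : ∀ t ∈ I, HasDerivAt δ (16 * lam ^ 2 * β t * γ t * δ t) t) :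
    (∀ s ∈ I, ∀ t ∈ I, α s * δ s - β s * γ s = α t * δ t - β t * γ t) ∧
    ((∀ t ∈ I, δ t ≠ 0) → ∀ s ∈ I, ∀ t ∈ I, α s / δ s = α t / δ t) ∧
    ((∀ t ∈ I, γ t ≠ 0) → ∀ s ∈ I, ∀ t ∈ I, β s / γ s = β t / γ t) := by
  refine ⟨?_, fun hδ0 => ?_, fun hγ0 => ?_⟩
  · refine hI.eq_of_hasDerivAt_eq_zero (f := fun t => α t * δ t - β t * γ t) fun t ht => ?_
    refine (((hα t ht).fun_mul (hδ t ht)).fun_sub ((hβ t ht).fun_mul (hγ t ht))).congr_deriv ?_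
    ring
  · refine hI.eq_of_hasDerivAt_eq_zero (f := fun t => α t / δ t) fun t ht => ?_
    refine ((hα t ht).fun_div (hδ t ht) (hδ0 t ht)).congr_deriv ?_
    ring
  · refine hI.eq_of_hasDerivAt_eq_zero (f := fun t => β t / γ t) fun t ht => ?_
    refine ((hβ t ht).fun_div (hγ t ht) (hγ0 t ht)).congr_deriv ?_
    ring
end

section
/- Explicit solution and finite-time blow-up of the solvmanifold Type IIA ODE system: let λ > 0 and α₀, β₀, γ₀, δ₀ > 0 with c := β₀γ₀ − α₀δ₀ ≠ 0. Set k := 32λ², T := (log(α₀δ₀) − log(β₀γ₀))/(k(α₀δ₀ − β₀γ₀)), and E(t) := β₀γ₀·e^{−kct} − α₀δ₀. Then T > 0, c/E(t) > 0 for all t ∈ [0, T), and the functions α(t) := α₀√(c/E(t)), β(t) := β₀√(c·e^{−kct}/E(t)), γ(t) := γ₀√(c·e^{−kct}/E(t)), δ(t) := δ₀√(c/E(t)) are differentiable on [0, T), satisfy α' = 16λ²αβγ, β' = 16λ²αβδ, γ' = 16λ²αγδ, δ' = 16λ²βγδ with initial values (α₀, β₀, γ₀, δ₀), and each of α, β,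 γ, δ tends to +∞ as t → T⁻. -/
open Filter

/-- Derivative of the factor `c / E` common to `α²` and `δ²` in the explicit solution, with `p = β₀γ₀`,
`q = α₀δ₀` and `c = p - q`. -/
theorem hasDerivAt_div_exp_sub {k p q t : ℝ}
    (hE : p * Real.exp (-(k * (p - q) * t)) - q ≠ 0) :
    HasDerivAt (fun s => (p - q) / (p * Real.exp (-(k * (p - q) * s)) - q))
      (k * p * ((p - q) / (p * Real.exp (-(k * (p - q) * t)) - q)) *
        ((p - q) * Real.exp (-(k * (p - q) * t)) /
          (p * Real.exp (-(k * (p - q) * t)) - q))) t := by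
  have hu : HasDerivAt (fun s => Real.exp (-(k * (p - q) * s)))
      (Real.exp (-(k * (p - q) * t)) * -(k * (p - q) * 1)) t :=
    ((hasDerivAt_id t).const_mul (k * (p - q))).neg.exp
  refine ((hasDerivAt_const t (p - q)).div ((hu.const_mul p).sub_const q) hE).congr_deriv ?_
  field_simp
  ring

theorem hasDerivAt_exp_div_exp_sub {k p q t : ℝ}
    (hE : p * Real.exp (-(k * (p - q) * t)) - q ≠ 0) :
    HasDerivAt (fun s => (p - q) * Real.exp (-(k * (p - q) * s)) /
        (p * Real.exp (-(k * (p - q) * s)) - q))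
      (k * q * ((p - q) / (p * Real.exp (-(k * (p - q) * t)) - q)) *
        ((p - q) * Real.exp (-(k * (p - q) * t)) /
          (p * Real.exp (-(k * (p - q) * t)) - q))) t := by
  have hu : HasDerivAt (fun s => Real.exp (-(k * (p - q) * s)))
      (Real.exp (-(k * (p - q) * t)) * -(k * (p - q) * 1)) t :=
    ((hasDerivAt_id t).const_mul (k * (p - q))).neg.exp
  refine ((hu.const_mul (p - q)).div ((hu.const_mul p).sub_const q) hE).congr_deriv ?_
  field_simp
  ring

theorem hasDerivAt_const_mul_sqrt {f : ℝ → ℝ} {a m t : ℝ}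
    (h : HasDerivAt f (2 * m * f t) t) (hf : 0 < f t) :
    HasDerivAt (fun s => a * Real.sqrt (f s)) (m * (a * Real.sqrt (f t))) t := by
  refine ((h.sqrt hf.ne').const_mul a).congr_deriv ?_
  have hs : Real.sqrt (f t) ≠ 0 := (Real.sqrt_pos.2 hf).ne'
  field_simp
  rw [Real.sq_sqrt hf.le]

theorem mul_exp_mul_sub_one_pos {c s : ℝ} (hc : c ≠ 0) (hs : 0 < s) :
    0 < c * (Real.exp (c * s) - 1) := by
  rcases hc.lt_or_gt with h | h
  · exact mul_pos_of_neg_of_neg h (sub_neg.2 (Real.exp_lt_one_iff.2 (mul_neg_of_neg_of_pos h hs)))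
  · exact mul_pos h (sub_pos.2 (Real.one_lt_exp_iff.2 (mul_pos h hs)))

theorem log_sub_log_div_sub_pos {p q : ℝ} (hp : 0 < p) (hq : 0 < q) (h : p ≠ q) :
    0 < (Real.log q - Real.log p) / (q - p) := by
  rcases h.lt_or_gt with h | h
  · exact div_pos (sub_pos.2 (Real.log_lt_log hp h)) (sub_pos.2 h)
  · exact div_pos_of_neg_of_neg (sub_neg.2 (Real.log_lt_log hq h)) (sub_neg.2 h)

/-- Explicit solution and finite-time blow-up of the solvmanifold Type IIA
ODE system in the non-critical case `c := β₀γ₀ − α₀δ₀ ≠ 0`. -/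
theorem solvmanifold_flow_explicit_blowup (lam α₀ β₀ γ₀ δ₀ : ℝ)
    (hlam : 0 < lam) (hα₀ : 0 < α₀) (hβ₀ : 0 < β₀) (hγ₀ : 0 < γ₀) (hδ₀ : 0 < δ₀)
    (hne : β₀ * γ₀ - α₀ * δ₀ ≠ 0) :
    let k : ℝ := 32 * lam ^ 2
    let c : ℝ := β₀ * γ₀ - α₀ * δ₀
    let T : ℝ := (Real.log (α₀ * δ₀) - Real.log (β₀ * γ₀)) / (k * (α₀ * δ₀ - β₀ * γ₀))
    let E : ℝ → ℝ := fun t => β₀ * γ₀ * Real.exp (-(k * c * t)) - α₀ * δ₀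
    let α : ℝ → ℝ := fun t => α₀ * Real.sqrt (c / E t)
    let β : ℝ → ℝ := fun t => β₀ * Real.sqrt (c * Real.exp (-(k * c * t)) / E t)
    let γ : ℝ → ℝ := fun t => γ₀ * Real.sqrt (c * Real.exp (-(k * c * t)) / E t)
    let δ : ℝ → ℝ := fun t => δ₀ * Real.sqrt (c / E t)
    0 < T ∧
    (∀ t ∈ Set.Ico (0 : ℝ) T, 0 < c / E t) ∧
    α 0 = α₀ ∧ β 0 = β₀ ∧ γ 0 = γ₀ ∧ δ 0 = δ₀ ∧
    (∀ t ∈ Set.Ico (0 : ℝ) T,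
      HasDerivWithinAt α (16 * lam ^ 2 * α t * β t * γ t) (Set.Ico (0 : ℝ) T) t ∧
      HasDerivWithinAt β (16 * lam ^ 2 * α t * β t * δ t) (Set.Ico (0 : ℝ) T) t ∧
      HasDerivWithinAt γ (16 * lam ^ 2 * α t * γ t * δ t) (Set.Ico (0 : ℝ) T) t ∧
      HasDerivWithinAt δ (16 * lam ^ 2 * β t * γ t * δ t) (Set.Ico (0 : ℝ) T) t) ∧
    Tendsto α (nhdsWithin T (Set.Iio T)) atTop ∧
    Tendsto β (nhdsWithin T (Set.Iio T)) atTop ∧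
    Tendsto γ (nhdsWithin T (Set.Iio T)) atTop ∧
    Tendsto δ (nhdsWithin T (Set.Iio T)) atTop := by
  intro k c T E α β γ δ
  have hk : 0 < k := by positivity
  have hp : 0 < β₀ * γ₀ := mul_pos hβ₀ hγ₀
  have hq : 0 < α₀ * δ₀ := mul_pos hα₀ hδ₀
  have hc : c ≠ 0 := hne
  have hT : 0 < T := by
    have h := div_pos (log_sub_log_div_sub_pos hp hq (sub_ne_zero.1 hne)) hk
    rwa [div_div, mul_comm _ k] at h
  have hkcT : k * c * T = Real.log (β₀ * γ₀) - Real.log (α₀ * δ₀) := by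
    have hne' : α₀ * δ₀ - β₀ * γ₀ ≠ 0 := sub_ne_zero.2 (sub_ne_zero.1 hne).symm
    simp only [T, c]
    field_simp
    ring
  have hE (t : ℝ) : E t = α₀ * δ₀ * (Real.exp (c * (k * (T - t))) - 1) := by
    have h : -(k * c * t) = c * (k * (T - t)) + (Real.log (α₀ * δ₀) - Real.log (β₀ * γ₀)) := by
      linear_combination -hkcT
    simp only [E]
    rw [h, Real.exp_add, Real.exp_sub, Real.exp_log hq, Real.exp_log hp]
    field_simp
  have hpos {t : ℝ} (ht : t < T) : 0 < c / E t := by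
    have h := mul_pos hq (mul_exp_mul_sub_one_pos hc (mul_pos hk (sub_pos.2 ht)))
    have hcE : 0 < c * E t := by
      rw [hE]
      linarith
    exact div_pos_iff.2 (mul_pos_iff.1 hcE)
  have hpos' {t : ℝ} (ht : t < T) : 0 < c * Real.exp (-(k * c * t)) / E t := by
    rw [mul_div_right_comm]
    exact mul_pos (hpos ht) (Real.exp_pos _)
  have hE0 : E 0 = c := by simp [E, c]
  have hcont : Continuous E := by fun_prop
  have hf : Tendsto (fun t => c / E t) (nhdsWithin T (Set.Iio T)) atTop := by
    have h0 : Tendsto (fun t => E t / c) (nhdsWithin T (Set.Iio T))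
        (nhdsWithin 0 (Set.Ioi 0)) := by
      refine tendsto_nhdsWithin_iff.2 ⟨?_, ?_⟩
      · have h := (hcont.div_const c).tendsto T
        rw [hE T] at h
        simp only [sub_self, mul_zero, Real.exp_zero, zero_div] at h
        exact h.mono_left nhdsWithin_le_nhds
      · filter_upwards [self_mem_nhdsWithin] with t ht
        rw [← inv_div]
        exact inv_pos.2 (hpos ht)
    simpa only [Function.comp_def, inv_div] using tendsto_inv_nhdsGT_zero.comp h0
  have hg : Tendsto (fun t => c * Real.exp (-(k * c * t)) / E t)
      (nhdsWithin T (Set.Iio T)) atTop := by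
    have hu : Continuous fun t => Real.exp (-(k * c * t)) := by fun_prop
    simp only [mul_div_right_comm]
    exact hf.atTop_mul_pos (Real.exp_pos _) ((hu.tendsto T).mono_left nhdsWithin_le_nhds)
  refine ⟨hT, fun t ht => hpos ht.2, ?_, ?_, ?_, ?_, fun t ht => ?_,
    (Real.tendsto_sqrt_atTop.comp hf).const_mul_atTop hα₀,
    (Real.tendsto_sqrt_atTop.comp hg).const_mul_atTop hβ₀,
    (Real.tendsto_sqrt_atTop.comp hg).const_mul_atTop hγ₀,
    (Real.tendsto_sqrt_atTop.comp hf).const_mul_atTop hδ₀⟩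
  · simp [α, hE0, hc]
  · simp [β, hE0, hc]
  · simp [γ, hE0, hc]
  · simp [δ, hE0, hc]
  have hEt : E t ≠ 0 := fun h => by simpa [h] using hpos ht.2
  have hαδ : α t * δ t = α₀ * δ₀ * (c / E t) := by
    simp only [α, δ]
    linear_combination α₀ * δ₀ * Real.mul_self_sqrt (hpos ht.2).le
  have hβγ : β t * γ t = β₀ * γ₀ * (c * Real.exp (-(k * c * t)) / E t) := by
    simp only [β, γ]
    linear_combination β₀ * γ₀ * Real.mul_self_sqrt (hpos' ht.2).le
  have hf' : HasDerivAt (fun s => c / E s) (2 * (16 * lam ^ 2 * (β t * γ t)) * (c / E t)) t := by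
    convert hasDerivAt_div_exp_sub (k := k) hEt using 1
    rw [hβγ]
    simp only [k, c, E]
    ring
  have hg' : HasDerivAt (fun s => c * Real.exp (-(k * c * s)) / E s)
      (2 * (16 * lam ^ 2 * (α t * δ t)) * (c * Real.exp (-(k * c * t)) / E t)) t := by
    convert hasDerivAt_exp_div_exp_sub (k := k) hEt using 1
    rw [hαδ]
    simp only [k, c, E]
    ring
  refine ⟨?_, ?_, ?_, ?_⟩ <;> apply HasDerivAt.hasDerivWithinAt
  · refine (hasDerivAt_const_mul_sqrt (a := α₀) hf' (hpos ht.2)).congr_deriv ?_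
    simp only [α]
    ring
  · refine (hasDerivAt_const_mul_sqrt (a := β₀) hg' (hpos' ht.2)).congr_deriv ?_
    simp only [β]
    ring
  · refine (hasDerivAt_const_mul_sqrt (a := γ₀) hg' (hpos' ht.2)).congr_deriv ?_
    simp only [γ]
    ring
  · refine (hasDerivAt_const_mul_sqrt (a := δ₀) hf' (hpos ht.2)).congr_deriv ?_
    simp only [δ]
    ring
end

section
/- Self-expanding solution in the critical case: let λ > 0 and α₀, β₀, γ₀, δ₀ > 0 with α₀δ₀ = β₀γ₀ = S > 0. Then the functions α(t) := α₀(1 − 32λ²St)^{−1/2}, β(t) := β₀(1 − 32λ²St)^{−1/2}, γ(t) := γ₀(1 − 32λ²St)^{−1/2}, δ(t) := δ₀(1 − 32λ²St)^{−1/2} solve the system α' = 16λ²αβγ, β' = 16λ²αβδ, γ' = 16λ²αγδ, δ' = 16λ²βγδ on [0, 1/(32λ²S)) with initial values (α₀, β₀, γ₀, δ₀), and each tends to +∞ as t → (1/(32λ²S))⁻. -/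
open Filter

theorem hasDerivAt_div_sqrt_one_sub_mul (a k t : ℝ) (ht : 0 < 1 - k * t) :
    HasDerivAt (fun t => a / Real.sqrt (1 - k * t))
      (a * k / (2 * Real.sqrt (1 - k * t) ^ 3)) t := by
  have hs : 0 < Real.sqrt (1 - k * t) := Real.sqrt_pos.2 ht
  have hlin : HasDerivAt (fun t => 1 - k * t) (-k) t := by
    simpa using ((hasDerivAt_id t).const_mul k).const_sub 1
  refine ((hasDerivAt_const t a).fun_div (hlin.sqrt ht.ne') hs.ne').congr_deriv ?_
  field_simp
  ring

theorem tendsto_div_sqrt_one_sub_mul_atTop {a k : ℝ} (ha : 0 < a) (hk : 0 < k) :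
    Tendsto (fun t => a / Real.sqrt (1 - k * t)) (nhdsWithin (1 / k) (Set.Iio (1 / k))) atTop := by
  have hsqrt : Tendsto (fun t => Real.sqrt (1 - k * t)) (nhdsWithin (1 / k) (Set.Iio (1 / k)))
      (nhdsWithin 0 (Set.Ioi 0)) := by
    refine tendsto_nhdsWithin_iff.2 ⟨?_, ?_⟩
    · have hcont : Continuous fun t => Real.sqrt (1 - k * t) := by fun_prop
      simpa [hk.ne'] using (hcont.tendsto (1 / k)).mono_left nhdsWithin_le_nhds
    · filter_upwards [self_mem_nhdsWithin] with t ht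
      have := (lt_div_iff₀' hk).1 (Set.mem_Iio.1 ht)
      exact Real.sqrt_pos.2 (by linarith)
  simpa only [div_eq_mul_inv, Function.comp_def] using
    (tendsto_inv_nhdsGT_zero.comp hsqrt).const_mul_atTop ha

/-- Self-expanding solution of the solvmanifold Type IIA ODE system in the
critical case `α₀δ₀ = β₀γ₀ = S > 0`: the rescaled data `(1 − 32λ²St)^{-1/2}·(α₀,β₀,γ₀,δ₀)`
solve the system on `[0, 1/(32λ²S))` and blow up at the final time. -/
theorem solvmanifold_flow_self_expander (lam α₀ β₀ γ₀ δ₀ S : ℝ)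
    (hlam : 0 < lam) (hα₀ : 0 < α₀) (hβ₀ : 0 < β₀) (hγ₀ : 0 < γ₀) (hδ₀ : 0 < δ₀)
    (hS : 0 < S) (h1 : α₀ * δ₀ = S) (h2 : β₀ * γ₀ = S) :
    let T : ℝ := 1 / (32 * lam ^ 2 * S)
    let α : ℝ → ℝ := fun t => α₀ / Real.sqrt (1 - 32 * lam ^ 2 * S * t)
    let β : ℝ → ℝ := fun t => β₀ / Real.sqrt (1 - 32 * lam ^ 2 * S * t)
    let γ : ℝ → ℝ := fun t => γ₀ / Real.sqrt (1 - 32 * lam ^ 2 * S * t)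
    let δ : ℝ → ℝ := fun t => δ₀ / Real.sqrt (1 - 32 * lam ^ 2 * S * t)
    α 0 = α₀ ∧ β 0 = β₀ ∧ γ 0 = γ₀ ∧ δ 0 = δ₀ ∧
    (∀ t ∈ Set.Ico (0 : ℝ) T,
      HasDerivWithinAt α (16 * lam ^ 2 * α t * β t * γ t) (Set.Ico (0 : ℝ) T) t ∧
      HasDerivWithinAt β (16 * lam ^ 2 * α t * β t * δ t) (Set.Ico (0 : ℝ) T) t ∧
      HasDerivWithinAt γ (16 * lam ^ 2 * α t * γ t * δ t) (Set.Ico (0 : ℝ) T) t ∧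
      HasDerivWithinAt δ (16 * lam ^ 2 * β t * γ t * δ t) (Set.Ico (0 : ℝ) T) t) ∧
    Tendsto α (nhdsWithin T (Set.Iio T)) atTop ∧
    Tendsto β (nhdsWithin T (Set.Iio T)) atTop ∧
    Tendsto γ (nhdsWithin T (Set.Iio T)) atTop ∧
    Tendsto δ (nhdsWithin T (Set.Iio T)) atTop := by
  intro T α β γ δ
  have hk : 0 < 32 * lam ^ 2 * S := by positivity
  refine ⟨by simp [α], by simp [β], by simp [γ], by simp [δ], fun t ht => ?_,
    tendsto_div_sqrt_one_sub_mul_atTop hα₀ hk, tendsto_div_sqrt_one_sub_mul_atTop hβ₀ hk,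
    tendsto_div_sqrt_one_sub_mul_atTop hγ₀ hk, tendsto_div_sqrt_one_sub_mul_atTop hδ₀ hk⟩
  have hpos : 0 < 1 - 32 * lam ^ 2 * S * t := by
    have := (lt_div_iff₀' hk).1 ht.2
    linarith
  have hderiv (a c : ℝ) (hc : c = a * (32 * lam ^ 2 * S) /
      (2 * Real.sqrt (1 - 32 * lam ^ 2 * S * t) ^ 3)) :
      HasDerivWithinAt (fun t => a / Real.sqrt (1 - 32 * lam ^ 2 * S * t)) c (Set.Ico 0 T) t :=
    hc ▸ (hasDerivAt_div_sqrt_one_sub_mul a _ t hpos).hasDerivWithinAt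
  refine ⟨hderiv _ _ ?_, hderiv _ _ ?_, hderiv _ _ ?_, hderiv _ _ ?_⟩ <;>
    simp only [α, β, γ, δ] <;>
    generalize Real.sqrt (1 - 32 * lam ^ 2 * S * t) = s
  · rw [← h2]
    ring
  · rw [← h1]
    ring
  · rw [← h1]
    ring
  · rw [← h2]
    ring
end

section
/- Evolution and lower bound of the Nijenhuis norm along the solvmanifold Type IIA flow: let λ > 0, T > 0, and let α, β, γ, δ : [0, T) → (0, ∞) be differentiable functions solving α' = 16λ²αβγ, β' = 16λ²αβδ, γ' = 16λ²αγδ, δ' = 16λ²βγδ with initial values α₀, β₀, γ₀, δ₀ > 0. Then for all t ∈ [0, T), the quantity |N|²(t) := 2λ²(α(t)δ(t) + β(t)γ(t))/√(α(t)β(t)γ(t)δ(t)) satisfies |N|²(t) = 2λ²( √(α₀δ₀/(β₀γ₀))·e^{16λ²(β₀γ₀−α₀δ₀)t} + √(β₀γ₀/(α₀δ₀))·e^{−16λ²(β₀γ₀−α₀δ₀)t} ), and in particular |N|²(t) ≥ 4λ² for all t. -/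
/-- A real function on a convex set whose derivative within the set vanishes is constant there. -/
theorem Convex.eq_of_hasDerivWithinAt_zero {f : ℝ → ℝ} {s : Set ℝ} (hs : Convex ℝ s)
    (hf : ∀ x ∈ s, HasDerivWithinAt f 0 s x) {x y : ℝ} (hx : x ∈ s) (hy : y ∈ s) :
    f x = f y := by
  have h := hs.norm_image_sub_le_of_norm_hasDerivWithin_le (C := 0) hf (by simp) hy hx
  rw [zero_mul, norm_le_zero_iff] at h
  exact sub_eq_zero.mp h

/-- If `u' = v' = κ u v` on `[0, T)` with `v` nonvanishing, then `u / v` evolves exponentially with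
rate `κ (v 0 - u 0)`. -/
theorem div_eq_mul_exp_of_hasDerivWithinAt {κ T : ℝ} {u v : ℝ → ℝ}
    (hv₀ : ∀ t ∈ Set.Ico (0 : ℝ) T, v t ≠ 0)
    (hu : ∀ t ∈ Set.Ico (0 : ℝ) T, HasDerivWithinAt u (κ * (u t * v t)) (Set.Ico (0 : ℝ) T) t)
    (hv : ∀ t ∈ Set.Ico (0 : ℝ) T, HasDerivWithinAt v (κ * (u t * v t)) (Set.Ico (0 : ℝ) T) t)
    {t : ℝ} (ht : t ∈ Set.Ico (0 : ℝ) T) :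
    u t / v t = u 0 / v 0 * Real.exp (κ * (v 0 - u 0) * t) := by
  have h0 : (0 : ℝ) ∈ Set.Ico (0 : ℝ) T := ⟨le_rfl, ht.1.trans_lt ht.2⟩
  have hdiff : ∀ s ∈ Set.Ico (0 : ℝ) T, v s - u s = v 0 - u 0 := fun s hs =>
    (convex_Ico 0 T).eq_of_hasDerivWithinAt_zero (f := fun x => v x - u x)
      (fun x hx => ((hv x hx).sub (hu x hx)).congr_deriv (sub_self _)) hs h0
  have hconst := (convex_Ico 0 T).eq_of_hasDerivWithinAt_zero
    (f := fun x => u x / v x * Real.exp (-(κ * (v 0 - u 0) * x))) (fun x hx => by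
      have hE : HasDerivWithinAt (fun x => Real.exp (-(κ * (v 0 - u 0) * x)))
          (Real.exp (-(κ * (v 0 - u 0) * x)) * (-(κ * (v 0 - u 0) * 1))) (Set.Ico 0 T) x :=
        (((hasDerivAt_id x).const_mul _).neg.exp).hasDerivWithinAt
      refine (((hu x hx).div (hv x hx) (hv₀ x hx)).mul hE).congr_deriv ?_
      have hvx := hv₀ x hx
      rw [← hdiff x hx, Pi.div_apply]
      field_simp
      ring) ht h0
  simp only [mul_zero, neg_zero, Real.exp_zero, mul_one, Real.exp_neg] at hconst
  rwa [← div_eq_mul_inv, div_eq_iff (Real.exp_ne_zero _)] at hconst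

/-- The symmetric quotient `(a + b) / √(ab)` splits as `√(a/b) + √(b/a)`. -/
theorem Real.add_div_sqrt_mul {a b : ℝ} (ha : 0 < a) (hb : 0 < b) :
    (a + b) / √(a * b) = √(a / b) + √(b / a) := by
  have h1 := Real.sqrt_pos.mpr ha
  have h2 := Real.sqrt_pos.mpr hb
  rw [Real.sqrt_mul ha.le, Real.sqrt_div ha.le, Real.sqrt_div hb.le]
  field_simp
  rw [Real.sq_sqrt ha.le, Real.sq_sqrt hb.le]

/-- The arithmetic-geometric mean inequality in quotient form. -/
theorem Real.two_le_add_div_sqrt_mul {a b : ℝ} (ha : 0 < a) (hb : 0 < b) :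
    2 ≤ (a + b) / √(a * b) := by
  rw [le_div_iff₀ (Real.sqrt_pos.mpr (mul_pos ha hb)), Real.sqrt_mul ha.le]
  nlinarith [sq_nonneg (√a - √b), Real.sq_sqrt ha.le, Real.sq_sqrt hb.le]

/-- Exponentials pull out of square roots with half the exponent. -/
theorem Real.sqrt_mul_exp_two_mul {a : ℝ} (ha : 0 ≤ a) (x : ℝ) :
    √(a * Real.exp (2 * x)) = √a * Real.exp x := by
  rw [Real.sqrt_mul ha, two_mul, Real.exp_add, Real.sqrt_mul_self (Real.exp_pos x).le]

/-- Evolution and lower bound of the Nijenhuis norm along the solvmanifold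
Type IIA flow: for positive solutions of the ODE system on `[0, T)` with positive initial
values, the quantity `|N|² = 2λ²(αδ + βγ)/√(αβγδ)` is given by the explicit exponential
formula and is bounded below by `4λ²`. -/
theorem solvmanifold_flow_nijenhuis_norm (lam T α₀ β₀ γ₀ δ₀ : ℝ)
    (hlam : 0 < lam) (hT : 0 < T)
    (hα₀ : 0 < α₀) (hβ₀ : 0 < β₀) (hγ₀ : 0 < γ₀) (hδ₀ : 0 < δ₀)
    (α β γ δ : ℝ → ℝ)
    (hposα : ∀ t ∈ Set.Ico (0 : ℝ) T, 0 < α t)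
    (hposβ : ∀ t ∈ Set.Ico (0 : ℝ) T, 0 < β t)
    (hposγ : ∀ t ∈ Set.Ico (0 : ℝ) T, 0 < γ t)
    (hposδ : ∀ t ∈ Set.Ico (0 : ℝ) T, 0 < δ t)
    (hα : ∀ t ∈ Set.Ico (0 : ℝ) T,
      HasDerivWithinAt α (16 * lam ^ 2 * α t * β t * γ t) (Set.Ico (0 : ℝ) T) t)
    (hβ : ∀ t ∈ Set.Ico (0 : ℝ) T,
      HasDerivWithinAt β (16 * lam ^ 2 * α t * β t * δ t) (Set.Ico (0 : ℝ) T) t)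
    (hγ : ∀ t ∈ Set.Ico (0 : ℝ) T,
      HasDerivWithinAt γ (16 * lam ^ 2 * α t * γ t * δ t) (Set.Ico (0 : ℝ) T) t)
    (hδ : ∀ t ∈ Set.Ico (0 : ℝ) T,
      HasDerivWithinAt δ (16 * lam ^ 2 * β t * γ t * δ t) (Set.Ico (0 : ℝ) T) t)
    (hinitα : α 0 = α₀) (hinitβ : β 0 = β₀) (hinitγ : γ 0 = γ₀) (hinitδ : δ 0 = δ₀) :
    ∀ t ∈ Set.Ico (0 : ℝ) T,
      (2 * lam ^ 2 * (α t * δ t + β t * γ t) / Real.sqrt (α t * β t * γ t * δ t)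
        = 2 * lam ^ 2 *
            (Real.sqrt ((α₀ * δ₀) / (β₀ * γ₀)) *
                Real.exp (16 * lam ^ 2 * (β₀ * γ₀ - α₀ * δ₀) * t)
              + Real.sqrt ((β₀ * γ₀) / (α₀ * δ₀)) *
                Real.exp (-(16 * lam ^ 2 * (β₀ * γ₀ - α₀ * δ₀) * t)))) ∧
      4 * lam ^ 2 ≤
        2 * lam ^ 2 * (α t * δ t + β t * γ t) / Real.sqrt (α t * β t * γ t * δ t) := by
  subst hinitα hinitβ hinitγ hinitδ
  intro t ht
  have hu : 0 < α t * δ t := mul_pos (hposα t ht) (hposδ t ht)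
  have hv : 0 < β t * γ t := mul_pos (hposβ t ht) (hposγ t ht)
  have hratio := div_eq_mul_exp_of_hasDerivWithinAt (κ := 32 * lam ^ 2) (T := T)
    (u := fun s => α s * δ s) (v := fun s => β s * γ s)
    (fun s hs => (mul_pos (hposβ s hs) (hposγ s hs)).ne')
    (fun s hs => ((hα s hs).mul (hδ s hs)).congr_deriv (by ring))
    (fun s hs => ((hβ s hs).mul (hγ s hs)).congr_deriv (by ring)) ht
  set k := 16 * lam ^ 2 * (β 0 * γ 0 - α 0 * δ 0) * t with hk
  have hexp : 32 * lam ^ 2 * (β 0 * γ 0 - α 0 * δ 0) * t = 2 * k := by rw [hk]; ring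
  simp only [hexp] at hratio
  have hratio' : β t * γ t / (α t * δ t) =
      β 0 * γ 0 / (α 0 * δ 0) * Real.exp (2 * -k) := by
    rw [← inv_div, hratio, mul_inv, inv_div, ← Real.exp_neg, mul_neg]
  rw [show α t * β t * γ t * δ t = α t * δ t * (β t * γ t) by ring, mul_div_assoc]
  constructor
  · rw [Real.add_div_sqrt_mul hu hv, hratio, hratio', Real.sqrt_mul_exp_two_mul (by positivity),
      Real.sqrt_mul_exp_two_mul (by positivity)]
  · nlinarith [Real.two_le_add_div_sqrt_mul hu hv, sq_nonneg lam]
end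

section
/- Hitchin's derivative formula: the set U := {φ ∈ Λ³(ℝ⁶)* : λ_φ < 0} is open, the function f : U → ℝ, f(φ) := √(−λ_φ), is differentiable on U, and for every φ ∈ U and every μ ∈ Λ³(ℝ⁶)* the directional derivative of f at φ in the direction μ equals the real number r determined by μ ∧ φ̂ = r·vol, where φ̂(x, y, z) := φ(J_φ x, J_φ y, J_φ z). -/
noncomputable section

/-- The underlying vector space `ℝ⁶`. -/
abbrev V6 : Type := Fin 6 → ℝ

/-- The space of component arrays of trilinear forms on `ℝ⁶`. -/
abbrev A6 : Type := Fin 6 → Fin 6 → Fin 6 → ℝ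

/-- The standard basis of `ℝ⁶`. -/
def e6 (i : Fin 6) : V6 := fun j => if j = i then (1 : ℝ) else 0

/-- The trilinear form with component array `c`. -/
def tri (c : A6) (x y z : V6) : ℝ :=
  ∑ i : Fin 6, ∑ j : Fin 6, ∑ k : Fin 6, c i j k * x i * y j * z k

/-- The volume form `vol = e¹∧⋯∧e⁶ = ω³/3!`. -/
def vol6 (v : Fin 6 → V6) : ℝ := (Matrix.of fun i j => v i j).det

/-- Wedge product of a 2-form and a 3-form (standard convention `1/(2!·3!)`). -/
def wedge23 (a : V6 → V6 → ℝ) (b : V6 → V6 → V6 → ℝ) (v : Fin 5 → V6) : ℝ :=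
  (1 / 12 : ℝ) * ∑ σ : Equiv.Perm (Fin 5),
    ((Equiv.Perm.sign σ : ℤ) : ℝ) *
      (a (v (σ 0)) (v (σ 1)) * b (v (σ 2)) (v (σ 3)) (v (σ 4)))

/-- Wedge product of two 3-forms (standard convention `1/(3!·3!)`). -/
def wedge33 (a b : V6 → V6 → V6 → ℝ) (v : Fin 6 → V6) : ℝ :=
  (1 / 36 : ℝ) * ∑ σ : Equiv.Perm (Fin 6),
    ((Equiv.Perm.sign σ : ℤ) : ℝ) *
      (a (v (σ 0)) (v (σ 1)) (v (σ 2)) * b (v (σ 3)) (v (σ 4)) (v (σ 5)))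

/-- Hitchin's map `K_φ`, characterized by `ι_{K_φ v} vol = -(ι_v φ) ∧ φ`. -/
def Kmap (φ : V6 → V6 → V6 → ℝ) (x : V6) : V6 := fun i =>
  (-1 : ℝ) ^ (i : ℕ) *
    (-(wedge23 (fun y z => φ x y z) φ (fun j => e6 (i.succAbove j))))

/-- Hitchin's invariant `λ_φ = (1/6)·tr(K_φ²)`. -/
def lamH (φ : V6 → V6 → V6 → ℝ) : ℝ :=
  (1 / 6 : ℝ) * ∑ i : Fin 6, Kmap φ (Kmap φ (e6 i)) i

/-- Hitchin's almost complex structure `J_φ = K_φ / √(-λ_φ)`. -/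
def Jmap (φ : V6 → V6 → V6 → ℝ) (x : V6) : V6 :=
  (Real.sqrt (-(lamH φ)))⁻¹ • Kmap φ x

/-- `φ̂(x,y,z) = φ(J_φ x, J_φ y, J_φ z)`. -/
def hatf (φ : V6 → V6 → V6 → ℝ) (x y z : V6) : ℝ :=
  φ (Jmap φ x) (Jmap φ y) (Jmap φ z)

/-- The space `Λ³(ℝ⁶)*` of 3-forms, realized as the submodule of alternating component
arrays. -/
def altForms : Submodule ℝ A6 where
  carrier := {c | (∀ i j k, c i j k = -c i k j) ∧ (∀ i j k, c i j k = -c j i k)}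
  add_mem' := by
    rintro a b ⟨ha1, ha2⟩ ⟨hb1, hb2⟩
    refine ⟨fun i j k => ?_, fun i j k => ?_⟩
    · simp only [Pi.add_apply]
      linarith [ha1 i j k, hb1 i j k]
    · simp only [Pi.add_apply]
      linarith [ha2 i j k, hb2 i j k]
  zero_mem' := by
    constructor <;> intro i j k <;> simp
  smul_mem' := by
    rintro r a ⟨ha1, ha2⟩
    refine ⟨fun i j k => ?_, fun i j k => ?_⟩
    · simp only [Pi.smul_apply, smul_eq_mul]
      rw [ha1 i j k]; ring
    · simp only [Pi.smul_apply, smul_eq_mul]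
      rw [ha2 i j k]; ring

/-- Signed sum over all permutations of `Fin n`. -/
def altSum {n : ℕ} (F : (Fin n → Fin n) → ℝ) : ℝ :=
  ∑ σ : Equiv.Perm (Fin n), ((Equiv.Perm.sign σ : ℤ) : ℝ) * F σ

theorem altSum_zero (F : (Fin 0 → Fin 0) → ℝ) : altSum F = F id := by
  simp only [altSum, Fintype.sum_unique]
  simp

theorem altSum_succ {n : ℕ} (F : (Fin (n + 1) → Fin (n + 1)) → ℝ) :
    altSum F = ∑ p : Fin (n + 1), (-1 : ℝ) ^ (p : ℕ) *
      altSum fun g : Fin n → Fin n => F (Fin.cons p (p.succAbove ∘ g)) := by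
  unfold altSum
  rw [Finset.univ_perm_fin_succ, ← Finset.univ_product_univ]
  simp only [Finset.sum_map, Equiv.toEmbedding_apply, Finset.sum_product]
  refine Finset.sum_congr rfl fun p _ => ?_
  refine Fin.cases ?_ (fun i => ?_) p
  · have key : ∀ σ : Equiv.Perm (Fin n), (⇑(Equiv.Perm.decomposeFin.symm (0, σ)) :
        Fin (n + 1) → Fin (n + 1)) = Fin.cons 0 ((0 : Fin (n + 1)).succAbove ∘ σ) := by
      intro σ
      funext x
      refine Fin.cases ?_ (fun x => ?_) x <;> simp
    simp [key, Equiv.Perm.decomposeFin.symm_sign]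
  · have h : ((-1 : ℝ) ^ ((i.succ : Fin (n + 1)) : ℕ)) =
        -(((Equiv.Perm.sign i.cycleRange : ℤ) : ℝ)) := by
      simp [Fin.sign_cycleRange, pow_succ]
    have key : ∀ σ : Equiv.Perm (Fin n), (⇑(Equiv.Perm.decomposeFin.symm (i.succ, σ)) :
        Fin (n + 1) → Fin (n + 1)) =
          Fin.cons i.succ (i.succ.succAbove ∘ (i.cycleRange * σ : Equiv.Perm (Fin n))) := by
      intro σ
      funext x
      refine Fin.cases ?_ (fun x => ?_) x <;> simp [Fin.succAbove_cycleRange]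
    conv_rhs => rw [← Equiv.sum_comp (Equiv.mulLeft i.cycleRange), Finset.mul_sum]
    refine Finset.sum_congr rfl fun σ _ => ?_
    rw [h, key, Equiv.Perm.decomposeFin.symm_sign, if_neg (Fin.succ_ne_zero i)]
    simp only [Equiv.coe_mulLeft, Equiv.Perm.sign_mul, Units.val_mul, Int.cast_mul]
    have hs : (((Equiv.Perm.sign i.cycleRange : ℤ) : ℝ)) *
        (((Equiv.Perm.sign i.cycleRange : ℤ) : ℝ)) = 1 := by
      rw [← Int.cast_mul, ← Units.val_mul, Int.units_mul_self]; simp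
    simp only [Units.val_neg, Units.val_one, Int.cast_neg, Int.cast_one]
    linear_combination (-((Equiv.Perm.sign σ : ℤ) : ℝ) *
      F (Fin.cons i.succ (i.succ.succAbove ∘ (i.cycleRange * σ : Equiv.Perm (Fin n))))) * (-hs)

theorem altSum_three {β : Fin 3 → Fin 3 → Fin 3 → ℝ} (h₁ : ∀ p q r, β p q r = -β p r q)
    (h₂ : ∀ p q r, β p q r = -β q p r) :
    altSum (fun g : Fin 3 → Fin 3 => β (g 0) (g 1) (g 2)) = 6 * β 0 1 2 := by
  have e : altSum (fun g : Fin 3 → Fin 3 => β (g 0) (g 1) (g 2)) =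
      β 0 1 2 - β 0 2 1 - (β 1 0 2 - β 1 2 0) + (β 2 0 1 - β 2 1 0) := by
    simp only [altSum_succ, altSum_zero, Fin.sum_univ_succ, Fin.sum_univ_zero]
    change (-1 : ℝ) ^ 0 * ((-1) ^ 0 * ((-1) ^ 0 * β 0 1 2 + 0) +
        ((-1) ^ 1 * ((-1) ^ 0 * β 0 2 1 + 0) + 0)) +
      ((-1 : ℝ) ^ 1 * ((-1) ^ 0 * ((-1) ^ 0 * β 1 0 2 + 0) +
        ((-1) ^ 1 * ((-1) ^ 0 * β 1 2 0 + 0) + 0)) +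
      ((-1 : ℝ) ^ 2 * ((-1) ^ 0 * ((-1) ^ 0 * β 2 0 1 + 0) +
        ((-1) ^ 1 * ((-1) ^ 0 * β 2 1 0 + 0) + 0)) + 0)) = _
    ring
  linarith [h₁ 0 1 2, h₁ 1 0 2, h₁ 2 0 1, h₂ 0 1 2, h₂ 0 2 1, h₂ 1 2 0]

theorem altSum_five_aux {α : Fin 5 → Fin 5 → ℝ} {β : Fin 5 → Fin 5 → Fin 5 → ℝ}
    (h₁ : ∀ p q r, β p q r = -β p r q) (h₂ : ∀ p q r, β p q r = -β q p r) :
    altSum (fun g : Fin 5 → Fin 5 => α (g 0) (g 1) * β (g 2) (g 3) (g 4)) =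
      ∑ p : Fin 5, (-1 : ℝ) ^ (p : ℕ) * ∑ q : Fin 4, (-1 : ℝ) ^ (q : ℕ) *
        (α p (p.succAbove q) * (6 * β (p.succAbove (q.succAbove 0)) (p.succAbove (q.succAbove 1))
          (p.succAbove (q.succAbove 2)))) := by
  rw [altSum_succ]
  refine Finset.sum_congr rfl fun p _ => ?_
  rw [altSum_succ]
  congr 1
  refine Finset.sum_congr rfl fun q _ => ?_
  rw [← altSum_three (β := fun i j k => β (p.succAbove (q.succAbove i))
    (p.succAbove (q.succAbove j)) (p.succAbove (q.succAbove k))) (fun _ _ _ => h₁ _ _ _)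
    (fun _ _ _ => h₂ _ _ _)]
  congr 1
  simp only [altSum, Finset.mul_sum]
  refine Finset.sum_congr rfl fun σ _ => ?_
  exact mul_left_comm _ _ _

theorem altSum_five {α : Fin 5 → Fin 5 → ℝ} {β : Fin 5 → Fin 5 → Fin 5 → ℝ}
    (h : ∀ p q, α p q = -α q p) (h₁ : ∀ p q r, β p q r = -β p r q)
    (h₂ : ∀ p q r, β p q r = -β q p r) :
    altSum (fun g : Fin 5 → Fin 5 => α (g 0) (g 1) * β (g 2) (g 3) (g 4)) = 12 *
      (α 0 1 * β 2 3 4 - α 0 2 * β 1 3 4 + α 0 3 * β 1 2 4 - α 0 4 * β 1 2 3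
        + α 1 2 * β 0 3 4 - α 1 3 * β 0 2 4 + α 1 4 * β 0 2 3
        + α 2 3 * β 0 1 4 - α 2 4 * β 0 1 3 + α 3 4 * β 0 1 2) := by
  rw [altSum_five_aux h₁ h₂]
  simp only [Fin.sum_univ_succ, Fin.sum_univ_zero]
  simp [Fin.succAbove, Fin.lt_def]
  rw [h 1 0, h 2 0, h 3 0, h 4 0, h 2 1, h 3 1, h 4 1, h 3 2, h 4 2, h 4 3]
  ring

theorem altSum_six {α β : Fin 6 → Fin 6 → Fin 6 → ℝ} :
    altSum (fun g : Fin 6 → Fin 6 => α (g 0) (g 1) (g 2) * β (g 3) (g 4) (g 5)) =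
      ∑ p : Fin 6, (-1 : ℝ) ^ (p : ℕ) * altSum fun g : Fin 5 → Fin 5 =>
        α p (p.succAbove (g 0)) (p.succAbove (g 1)) *
          β (p.succAbove (g 2)) (p.succAbove (g 3)) (p.succAbove (g 4)) :=
  altSum_succ _

/-- The bilinear map in `a` and `b` whose diagonal is the matrix of Hitchin's `K`: the vector
`∑ i, kCoeff a b i j • e6 i` represents the 5-form `-(ι_{e6 j} a) ∧ b` through the volume form. -/
def kCoeff (a b : A6) (i j : Fin 6) : ℝ :=
  -(-1 : ℝ) ^ (i : ℕ) * ((fun (α : Fin 5 → Fin 5 → ℝ) (β : Fin 5 → Fin 5 → Fin 5 → ℝ) =>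
      α 0 1 * β 2 3 4 - α 0 2 * β 1 3 4 + α 0 3 * β 1 2 4 - α 0 4 * β 1 2 3
        + α 1 2 * β 0 3 4 - α 1 3 * β 0 2 4 + α 1 4 * β 0 2 3
        + α 2 3 * β 0 1 4 - α 2 4 * β 0 1 3 + α 3 4 * β 0 1 2)
    (fun p q => a j (i.succAbove p) (i.succAbove q))
    (fun p q r => b (i.succAbove p) (i.succAbove q) (i.succAbove r)))

theorem swap12 {c : A6} (h : c ∈ altForms) (i j k : Fin 6) (_ : j < i) :
    c i j k = -c j i k := h.2 i j k

theorem swap23 {c : A6} (h : c ∈ altForms) (i j k : Fin 6) (_ : k < j) :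
    c i j k = -c i k j := h.1 i j k

theorem diag12 {c : A6} (h : c ∈ altForms) (i k : Fin 6) : c i i k = 0 := by linarith [h.2 i i k]

theorem diag23 {c : A6} (h : c ∈ altForms) (i k : Fin 6) : c i k k = 0 := by linarith [h.1 i k k]

set_option maxHeartbeats 4000000 in
theorem kCoeff_table {c : A6} (h : c ∈ altForms) :
    kCoeff c c 0 0 = -c 0 1 2 * c 3 4 5 + c 0 1 3 * c 2 4 5 - c 0 1 4 * c 2 3 5
      + c 0 1 5 * c 2 3 4 - c 0 2 3 * c 1 4 5 + c 0 2 4 * c 1 3 5 - c 0 2 5 * c 1 3 4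
      - c 0 3 4 * c 1 2 5 + c 0 3 5 * c 1 2 4 - c 0 4 5 * c 1 2 3 ∧
    kCoeff c c 0 1 = 2 * (-c 1 2 3 * c 1 4 5 + c 1 2 4 * c 1 3 5 - c 1 2 5 * c 1 3 4) ∧
    kCoeff c c 0 2 = 2 * (-c 1 2 3 * c 2 4 5 + c 1 2 4 * c 2 3 5 - c 1 2 5 * c 2 3 4) ∧
    kCoeff c c 0 3 = 2 * (-c 1 2 3 * c 3 4 5 + c 1 3 4 * c 2 3 5 - c 1 3 5 * c 2 3 4) ∧
    kCoeff c c 0 4 = 2 * (-c 1 2 4 * c 3 4 5 + c 1 3 4 * c 2 4 5 - c 1 4 5 * c 2 3 4) ∧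
    kCoeff c c 0 5 = 2 * (-c 1 2 5 * c 3 4 5 + c 1 3 5 * c 2 4 5 - c 1 4 5 * c 2 3 5) ∧
    kCoeff c c 1 0 = 2 * (c 0 2 3 * c 0 4 5 - c 0 2 4 * c 0 3 5 + c 0 2 5 * c 0 3 4) ∧
    kCoeff c c 1 1 = -c 0 1 2 * c 3 4 5 + c 0 1 3 * c 2 4 5 - c 0 1 4 * c 2 3 5
      + c 0 1 5 * c 2 3 4 + c 0 2 3 * c 1 4 5 - c 0 2 4 * c 1 3 5 + c 0 2 5 * c 1 3 4
      + c 0 3 4 * c 1 2 5 - c 0 3 5 * c 1 2 4 + c 0 4 5 * c 1 2 3 ∧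
    kCoeff c c 1 2 = 2 * (c 0 2 3 * c 2 4 5 - c 0 2 4 * c 2 3 5 + c 0 2 5 * c 2 3 4) ∧
    kCoeff c c 1 3 = 2 * (c 0 2 3 * c 3 4 5 - c 0 3 4 * c 2 3 5 + c 0 3 5 * c 2 3 4) ∧
    kCoeff c c 1 4 = 2 * (c 0 2 4 * c 3 4 5 - c 0 3 4 * c 2 4 5 + c 0 4 5 * c 2 3 4) ∧
    kCoeff c c 1 5 = 2 * (c 0 2 5 * c 3 4 5 - c 0 3 5 * c 2 4 5 + c 0 4 5 * c 2 3 5) ∧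
    kCoeff c c 2 0 = 2 * (-c 0 1 3 * c 0 4 5 + c 0 1 4 * c 0 3 5 - c 0 1 5 * c 0 3 4) ∧
    kCoeff c c 2 1 = 2 * (-c 0 1 3 * c 1 4 5 + c 0 1 4 * c 1 3 5 - c 0 1 5 * c 1 3 4) ∧
    kCoeff c c 2 2 = -c 0 1 2 * c 3 4 5 - c 0 1 3 * c 2 4 5 + c 0 1 4 * c 2 3 5
      - c 0 1 5 * c 2 3 4 - c 0 2 3 * c 1 4 5 + c 0 2 4 * c 1 3 5 - c 0 2 5 * c 1 3 4
      + c 0 3 4 * c 1 2 5 - c 0 3 5 * c 1 2 4 + c 0 4 5 * c 1 2 3 ∧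
    kCoeff c c 2 3 = 2 * (-c 0 1 3 * c 3 4 5 + c 0 3 4 * c 1 3 5 - c 0 3 5 * c 1 3 4) ∧
    kCoeff c c 2 4 = 2 * (-c 0 1 4 * c 3 4 5 + c 0 3 4 * c 1 4 5 - c 0 4 5 * c 1 3 4) ∧
    kCoeff c c 2 5 = 2 * (-c 0 1 5 * c 3 4 5 + c 0 3 5 * c 1 4 5 - c 0 4 5 * c 1 3 5) ∧
    kCoeff c c 3 0 = 2 * (c 0 1 2 * c 0 4 5 - c 0 1 4 * c 0 2 5 + c 0 1 5 * c 0 2 4) ∧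
    kCoeff c c 3 1 = 2 * (c 0 1 2 * c 1 4 5 - c 0 1 4 * c 1 2 5 + c 0 1 5 * c 1 2 4) ∧
    kCoeff c c 3 2 = 2 * (c 0 1 2 * c 2 4 5 - c 0 2 4 * c 1 2 5 + c 0 2 5 * c 1 2 4) ∧
    kCoeff c c 3 3 = c 0 1 2 * c 3 4 5 + c 0 1 3 * c 2 4 5 + c 0 1 4 * c 2 3 5
      - c 0 1 5 * c 2 3 4 - c 0 2 3 * c 1 4 5 - c 0 2 4 * c 1 3 5 + c 0 2 5 * c 1 3 4
      - c 0 3 4 * c 1 2 5 + c 0 3 5 * c 1 2 4 + c 0 4 5 * c 1 2 3 ∧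
    kCoeff c c 3 4 = 2 * (c 0 1 4 * c 2 4 5 - c 0 2 4 * c 1 4 5 + c 0 4 5 * c 1 2 4) ∧
    kCoeff c c 3 5 = 2 * (c 0 1 5 * c 2 4 5 - c 0 2 5 * c 1 4 5 + c 0 4 5 * c 1 2 5) ∧
    kCoeff c c 4 0 = 2 * (-c 0 1 2 * c 0 3 5 + c 0 1 3 * c 0 2 5 - c 0 1 5 * c 0 2 3) ∧
    kCoeff c c 4 1 = 2 * (-c 0 1 2 * c 1 3 5 + c 0 1 3 * c 1 2 5 - c 0 1 5 * c 1 2 3) ∧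
    kCoeff c c 4 2 = 2 * (-c 0 1 2 * c 2 3 5 + c 0 2 3 * c 1 2 5 - c 0 2 5 * c 1 2 3) ∧
    kCoeff c c 4 3 = 2 * (-c 0 1 3 * c 2 3 5 + c 0 2 3 * c 1 3 5 - c 0 3 5 * c 1 2 3) ∧
    kCoeff c c 4 4 = c 0 1 2 * c 3 4 5 - c 0 1 3 * c 2 4 5 - c 0 1 4 * c 2 3 5
      - c 0 1 5 * c 2 3 4 + c 0 2 3 * c 1 4 5 + c 0 2 4 * c 1 3 5 + c 0 2 5 * c 1 3 4
      - c 0 3 4 * c 1 2 5 - c 0 3 5 * c 1 2 4 - c 0 4 5 * c 1 2 3 ∧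
    kCoeff c c 4 5 = 2 * (-c 0 1 5 * c 2 3 5 + c 0 2 5 * c 1 3 5 - c 0 3 5 * c 1 2 5) ∧
    kCoeff c c 5 0 = 2 * (c 0 1 2 * c 0 3 4 - c 0 1 3 * c 0 2 4 + c 0 1 4 * c 0 2 3) ∧
    kCoeff c c 5 1 = 2 * (c 0 1 2 * c 1 3 4 - c 0 1 3 * c 1 2 4 + c 0 1 4 * c 1 2 3) ∧
    kCoeff c c 5 2 = 2 * (c 0 1 2 * c 2 3 4 - c 0 2 3 * c 1 2 4 + c 0 2 4 * c 1 2 3) ∧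
    kCoeff c c 5 3 = 2 * (c 0 1 3 * c 2 3 4 - c 0 2 3 * c 1 3 4 + c 0 3 4 * c 1 2 3) ∧
    kCoeff c c 5 4 = 2 * (c 0 1 4 * c 2 3 4 - c 0 2 4 * c 1 3 4 + c 0 3 4 * c 1 2 4) ∧
    kCoeff c c 5 5 = c 0 1 2 * c 3 4 5 - c 0 1 3 * c 2 4 5 + c 0 1 4 * c 2 3 5
      + c 0 1 5 * c 2 3 4 + c 0 2 3 * c 1 4 5 - c 0 2 4 * c 1 3 5 - c 0 2 5 * c 1 3 4
      + c 0 3 4 * c 1 2 5 + c 0 3 5 * c 1 2 4 - c 0 4 5 * c 1 2 3 := by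
  refine ⟨?_, ?_, ?_, ?_, ?_, ?_, ?_, ?_, ?_, ?_, ?_, ?_, ?_, ?_, ?_, ?_, ?_, ?_, ?_, ?_, ?_, ?_,
    ?_, ?_, ?_, ?_, ?_, ?_, ?_, ?_, ?_, ?_, ?_, ?_, ?_, ?_⟩ <;>
  · simp [kCoeff, Fin.succAbove, Fin.lt_def, swap12 h, swap23 h, diag12 h, diag23 h]
    ring

set_option maxHeartbeats 4000000 in
theorem kCoeff_sq {c : A6} (h : c ∈ altForms) (i j : Fin 6) :
    ∑ l, kCoeff c c i l * kCoeff c c l j =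
    if i = j then (1 / 6) * ∑ k, ∑ l, kCoeff c c k l * kCoeff c c l k else 0 := by
  simp only [Fin.sum_univ_six]
  fin_cases i <;> fin_cases j <;>
  · simp only [Fin.zero_eta, Fin.mk_one, Fin.reduceFinMk, Fin.isValue, Fin.reduceEq,
      if_true, if_false, kCoeff_table h]
    ring

/-- The component array of the form `(x, y, z) ↦ φ(K_φ x, y, z)`, where `φ = tri c`. -/
def kContract (c : A6) (i j k : Fin 6) : ℝ := ∑ l, kCoeff c c l i * c l j k

set_option maxHeartbeats 4000000 in
theorem kContract_swap {c : A6} (h : c ∈ altForms) (i j k : Fin 6) :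
    kContract c i j k = -kContract c j i k := by
  wlog hij : i ≤ j
  · linarith [this h j i k (by lia)]
  simp only [kContract, Fin.sum_univ_six]
  fin_cases i <;> fin_cases j <;> first | (exfalso; revert hij; decide) | skip
  all_goals
    clear hij
    fin_cases k <;>
    · simp [swap12 h, swap23 h, diag12 h, diag23 h, kCoeff_table h]
      try ring

set_option maxRecDepth 10000 in
set_option maxHeartbeats 40000000 in
theorem sum_kCoeff_mul_polar {c m : A6} (h : c ∈ altForms) (hm : m ∈ altForms) :
    (1 / 3) * ∑ i, ∑ j, kCoeff c c i j * (kCoeff c m j i + kCoeff m c j i) =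
      2 * -((1 / 3) * ∑ i, kCoeff m (kContract c) i i) := by
  simp only [Fin.sum_univ_six, kCoeff_table h]
  simp [kCoeff, Fin.succAbove, Fin.lt_def, swap12 h, swap23 h, diag12 h, diag23 h,
    swap12 hm, swap23 hm, diag12 hm, diag23 hm]
  simp [kContract, Fin.sum_univ_six, swap12 h, swap23 h, diag12 h, diag23 h, kCoeff_table h]
  ring

theorem tri_add_left (c : A6) (x x' y z : V6) :
    tri c (x + x') y z = tri c x y z + tri c x' y z := by
  simp only [tri, Pi.add_apply, mul_add, add_mul, Finset.sum_add_distrib]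

theorem tri_smul_left (c : A6) (r : ℝ) (x y z : V6) : tri c (r • x) y z = r * tri c x y z := by
  simp only [tri, Pi.smul_apply, smul_eq_mul, Finset.mul_sum]
  exact Finset.sum_congr rfl fun _ _ => Finset.sum_congr rfl fun _ _ =>
    Finset.sum_congr rfl fun _ _ => by ring

theorem tri_swap12 {c : A6} (h : c ∈ altForms) (x y z : V6) : tri c x y z = -tri c y x z := by
  unfold tri
  rw [Finset.sum_comm]
  simp only [← Finset.sum_neg_distrib]
  refine Finset.sum_congr rfl fun i _ => Finset.sum_congr rfl fun j _ =>
    Finset.sum_congr rfl fun k _ => ?_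
  rw [h.2 j i k]
  ring

theorem tri_swap23 {c : A6} (h : c ∈ altForms) (x y z : V6) : tri c x y z = -tri c x z y := by
  unfold tri
  simp only [← Finset.sum_neg_distrib]
  refine Finset.sum_congr rfl fun i _ => ?_
  rw [Finset.sum_comm]
  refine Finset.sum_congr rfl fun j _ => Finset.sum_congr rfl fun k _ => ?_
  rw [h.1 i k j]
  ring

theorem tri_rotate (c : A6) (x y z : V6) : tri c x y z = tri (fun i j k => c k i j) y z x := by
  unfold tri
  rw [Finset.sum_comm]
  refine Finset.sum_congr rfl fun i _ => ?_
  rw [Finset.sum_comm]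
  exact Finset.sum_congr rfl fun j _ => Finset.sum_congr rfl fun k _ => by ring

theorem tri_add_mid (c : A6) (x y y' z : V6) :
    tri c x (y + y') z = tri c x y z + tri c x y' z := by
  simp only [tri_rotate c, tri_add_left]

theorem tri_smul_mid (c : A6) (r : ℝ) (x y z : V6) : tri c x (r • y) z = r * tri c x y z := by
  simp only [tri_rotate c, tri_smul_left]

theorem tri_add_right (c : A6) (x y z z' : V6) :
    tri c x y (z + z') = tri c x y z + tri c x y z' := by
  simp only [tri_rotate c x, tri_add_mid]

theorem tri_smul_right (c : A6) (r : ℝ) (x y z : V6) : tri c x y (r • z) = r * tri c x y z := by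
  simp only [tri_rotate c x, tri_smul_mid]

theorem tri_basis_right (c : A6) (x : V6) (j k : Fin 6) :
    tri c x (e6 j) (e6 k) = ∑ i, c i j k * x i := by
  simp [tri, e6]

theorem tri_basis (c : A6) (i j k : Fin 6) : tri c (e6 i) (e6 j) (e6 k) = c i j k := by
  simp [tri_basis_right, e6]

theorem tri_smul (r : ℝ) (c : A6) (x y z : V6) : tri (r • c) x y z = r * tri c x y z := by
  simp only [tri, Pi.smul_apply, smul_eq_mul, Finset.mul_sum, mul_assoc]

theorem Kmap_tri {c : A6} (h : c ∈ altForms) (x : V6) (i : Fin 6) :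
    Kmap (tri c) x i = ∑ j, kCoeff c c i j * x j := by
  have e := altSum_five
    (α := fun p q => tri c x (e6 (i.succAbove p)) (e6 (i.succAbove q)))
    (β := fun p q r => c (i.succAbove p) (i.succAbove q) (i.succAbove r))
    (fun _ _ => tri_swap23 h _ _ _) (fun _ _ _ => h.1 _ _ _) (fun _ _ _ => h.2 _ _ _)
  unfold altSum at e
  simp only [Kmap, wedge23, tri_basis c]
  rw [e]
  simp only [kCoeff, tri_basis_right, Fin.sum_univ_six]
  ring

theorem lamH_tri {c : A6} (h : c ∈ altForms) :
    lamH (tri c) = (1 / 6) * ∑ i, ∑ l, kCoeff c c i l * kCoeff c c l i := by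
  have he : ∀ (f : Fin 6 → ℝ) i, ∑ j, f j * e6 i j = f i := fun f i => by simp [e6]
  rw [lamH]
  congr 1
  refine Finset.sum_congr rfl fun i _ => ?_
  rw [Kmap_tri h]
  exact Finset.sum_congr rfl fun l _ => by rw [Kmap_tri h, he]

theorem Kmap_Kmap {c : A6} (h : c ∈ altForms) (x : V6) :
    Kmap (tri c) (Kmap (tri c) x) = lamH (tri c) • x := by
  have hsq (i j : Fin 6) : ∑ l, kCoeff c c i l * kCoeff c c l j =
      if i = j then lamH (tri c) else 0 := by
    rw [kCoeff_sq h, ← lamH_tri h]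
  funext i
  rw [Kmap_tri h]
  simp only [Kmap_tri h, Finset.mul_sum, ← mul_assoc]
  rw [Finset.sum_comm]
  simp only [← Finset.sum_mul, hsq]
  simp [ite_mul]

theorem kContract_mem {c : A6} (h : c ∈ altForms) : kContract c ∈ altForms := by
  refine ⟨fun i j k => ?_, kContract_swap h⟩
  rw [kContract, kContract, ← Finset.sum_neg_distrib]
  exact Finset.sum_congr rfl fun l _ => by rw [h.1 l]; ring

theorem tri_Kmap {c : A6} (h : c ∈ altForms) (x y z : V6) :
    tri c (Kmap (tri c) x) y z = tri (kContract c) x y z := by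
  have comm : ∀ F : Fin 6 → Fin 6 → Fin 6 → ℝ,
      ∑ j, ∑ k, ∑ l, F j k l = ∑ l, ∑ j, ∑ k, F j k l := fun F =>
    (Finset.sum_congr rfl fun j _ => Finset.sum_comm).trans Finset.sum_comm
  simp only [tri, Kmap_tri h, kContract, Finset.mul_sum, Finset.sum_mul]
  calc _ = ∑ i, ∑ l, ∑ j, ∑ k, c i j k * (kCoeff c c i l * x l) * y j * z k :=
        Finset.sum_congr rfl fun i _ => comm _
    _ = ∑ l, ∑ i, ∑ j, ∑ k, c i j k * (kCoeff c c i l * x l) * y j * z k := Finset.sum_comm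
    _ = _ := Finset.sum_congr rfl fun l _ => by
        conv_rhs => rw [comm]
        exact Finset.sum_congr rfl fun i _ => Finset.sum_congr rfl fun j _ =>
          Finset.sum_congr rfl fun k _ => by ring

theorem tri_Kmap_Kmap_Kmap {c : A6} (h : c ∈ altForms) (x y z : V6) :
    tri c (Kmap (tri c) x) (Kmap (tri c) y) (Kmap (tri c) z) =
      lamH (tri c) * tri (kContract c) x y z := by
  have hT := kContract_mem h
  rw [tri_Kmap h, tri_swap12 hT, ← tri_Kmap h (Kmap (tri c) y), Kmap_Kmap h, tri_smul_left,
    tri_swap23 h y, tri_swap12 h y, tri_Kmap h z, tri_swap23 hT z, tri_swap12 hT z,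
    tri_swap23 hT x]
  ring

theorem hatf_tri {c : A6} (h : c ∈ altForms) (hc : lamH (tri c) < 0) :
    hatf (tri c) = tri ((-(Real.sqrt (-lamH (tri c)))⁻¹) • kContract c) := by
  funext x y z
  have hs : Real.sqrt (-lamH (tri c)) ^ 2 = -lamH (tri c) := Real.sq_sqrt (by linarith)
  have h0 : Real.sqrt (-lamH (tri c)) ≠ 0 := (Real.sqrt_pos.2 (by linarith)).ne'
  simp only [hatf, Jmap, tri_smul_left, tri_smul_mid, tri_smul_right, tri_smul,
    tri_Kmap_Kmap_Kmap h]
  field_simp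
  rw [hs]; ring

/-- `(v₀, …, v₅) ↦ a(v₀, v₁, v₂) b(v₃, v₄, v₅)` as a multilinear map. -/
def triMulTri (a b : A6) : MultilinearMap ℝ (fun _ : Fin 6 => V6) ℝ :=
  MultilinearMap.mk' (fun v => tri a (v 0) (v 1) (v 2) * tri b (v 3) (v 4) (v 5))
    (fun v i x y => by
      fin_cases i <;> simp [tri_add_left, tri_add_mid, tri_add_right] <;> ring)
    (fun v i r x => by
      fin_cases i <;> simp [tri_smul_left, tri_smul_mid, tri_smul_right] <;> ring)

theorem wedge33_tri_eq_alternatization (a b : A6) (v : Fin 6 → V6) :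
    wedge33 (tri a) (tri b) v = (1 / 36) * (triMulTri a b).alternatization v := by
  rw [MultilinearMap.alternatization_apply]
  simp [wedge33, triMulTri, Units.smul_def]

theorem wedge33_tri (a b : A6) (v : Fin 6 → V6) :
    wedge33 (tri a) (tri b) v = wedge33 (tri a) (tri b) e6 * vol6 v := by
  have he : (Pi.basisFun ℝ (Fin 6) : Fin 6 → V6) = e6 := by
    funext i j
    simp [e6, Pi.single_apply]
  rw [wedge33_tri_eq_alternatization, wedge33_tri_eq_alternatization,
    AlternatingMap.eq_smul_basis_det (Pi.basisFun ℝ (Fin 6)) (triMulTri a b).alternatization]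
  simp only [AlternatingMap.smul_apply, he, smul_eq_mul]
  have hv : ∀ w : Fin 6 → V6, (Pi.basisFun ℝ (Fin 6)).det w = vol6 w := fun w => by
    rw [Pi.basisFun_det_apply, vol6]
  rw [← he, Module.Basis.det_self, he, hv]
  ring

theorem wedge33_tri_e6 {a b : A6} (ha : a ∈ altForms) (hb : b ∈ altForms) :
    wedge33 (tri a) (tri b) e6 = -((1 / 3) * ∑ i, kCoeff a b i i) := by
  have e := altSum_six (α := a) (β := b)
  rw [altSum] at e
  simp only [wedge33, tri_basis, e]
  have e' : ∀ p : Fin 6, (-1 : ℝ) ^ (p : ℕ) * altSum (fun g : Fin 5 → Fin 5 =>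
        a p (p.succAbove (g 0)) (p.succAbove (g 1)) *
          b (p.succAbove (g 2)) (p.succAbove (g 3)) (p.succAbove (g 4))) = -12 * kCoeff a b p p := by
    intro p
    rw [altSum_five (α := fun i j => a p (p.succAbove i) (p.succAbove j))
      (β := fun i j k => b (p.succAbove i) (p.succAbove j) (p.succAbove k))
      (fun _ _ => ha.1 _ _ _) (fun _ _ _ => hb.1 _ _ _) (fun _ _ _ => hb.2 _ _ _), kCoeff]
    ring
  simp only [e', ← Finset.mul_sum]
  ring

theorem kCoeff_smul_right (r : ℝ) (a b : A6) (i j : Fin 6) :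
    kCoeff a (r • b) i j = r * kCoeff a b i j := by
  simp only [kCoeff, Pi.smul_apply, smul_eq_mul]
  ring

theorem hasDerivAt_kCoeff (c m : A6) (i j : Fin 6) :
    HasDerivAt (fun s : ℝ => kCoeff (c + s • m) (c + s • m) i j)
      (kCoeff c m i j + kCoeff m c i j) 0 := by
  have e : (fun s : ℝ => kCoeff (c + s • m) (c + s • m) i j) =
      fun s => kCoeff c c i j + s * (kCoeff c m i j + kCoeff m c i j) + s ^ 2 * kCoeff m m i j := by
    funext s
    simp only [kCoeff, Pi.add_apply, Pi.smul_apply, smul_eq_mul]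
    ring
  rw [e]
  have := (((hasDerivAt_id (0 : ℝ)).mul_const (kCoeff c m i j + kCoeff m c i j)).const_add
    (kCoeff c c i j)).fun_add ((hasDerivAt_pow 2 (0 : ℝ)).mul_const (kCoeff m m i j))
  simpa using this

theorem hasDerivAt_lamH {c m : A6} (hc : c ∈ altForms) (hm : m ∈ altForms) :
    HasDerivAt (fun s : ℝ => lamH (tri (c + s • m)))
      (2 * wedge33 (tri m) (tri (kContract c)) e6) 0 := by
  have e : (fun s : ℝ => lamH (tri (c + s • m))) = fun s : ℝ => (1 / 6) * ∑ i, ∑ j,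
      kCoeff (c + s • m) (c + s • m) i j * kCoeff (c + s • m) (c + s • m) j i :=
    funext fun s => lamH_tri (altForms.add_mem hc (altForms.smul_mem s hm))
  rw [e, wedge33_tri_e6 hm (kContract_mem hc), ← sum_kCoeff_mul_polar hc hm]
  have := (HasDerivAt.fun_sum fun i (_ : i ∈ Finset.univ) =>
    HasDerivAt.fun_sum fun j (_ : j ∈ Finset.univ) =>
      (hasDerivAt_kCoeff c m i j).fun_mul (hasDerivAt_kCoeff c m j i)).const_mul (1 / 6 : ℝ)
  refine this.congr_deriv ?_
  simp only [zero_smul, add_zero, Finset.sum_add_distrib]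
  rw [Finset.sum_comm (f := fun i j => (kCoeff c m i j + kCoeff m c i j) * kCoeff c c j i)]
  simp only [mul_comm (kCoeff c m _ _ + kCoeff m c _ _)]
  ring

theorem differentiable_kCoeff (i j : Fin 6) : Differentiable ℝ fun c : A6 => kCoeff c c i j := by
  simp only [kCoeff]
  fun_prop

theorem differentiable_lamH : Differentiable ℝ fun c : altForms => lamH (tri c.1) := by
  have e : (fun c : altForms => lamH (tri c.1)) = (fun c : A6 => (1 / 6) * ∑ i, ∑ l,
      kCoeff c c i l * kCoeff c c l i) ∘ altForms.subtypeL := funext fun c => lamH_tri c.2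
  rw [e]
  refine Differentiable.comp ?_ altForms.subtypeL.differentiable
  have := differentiable_kCoeff
  fun_prop

/-- Hitchin's derivative formula: `U = {φ : λ_φ < 0}` is open,
`f(φ) = √(−λ_φ)` is differentiable on `U`, and its directional derivative at `φ` in the
direction μ is the real number `r` determined by `μ ∧ φ̂ = r · vol`. -/
theorem hitchin_derivative_formula :
    IsOpen {c : altForms | lamH (tri c.1) < 0} ∧
    DifferentiableOn ℝ (fun c : altForms => Real.sqrt (-(lamH (tri c.1))))
      {c : altForms | lamH (tri c.1) < 0} ∧
    ∀ c : altForms, lamH (tri c.1) < 0 → ∀ m : altForms,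
      ∃ r : ℝ,
        (∀ v : Fin 6 → V6, wedge33 (tri m.1) (hatf (tri c.1)) v = r * vol6 v) ∧
        HasDerivAt (fun s : ℝ => Real.sqrt (-(lamH (tri ((c + s • m : altForms) : altForms).1))))
          r 0 := by
  refine ⟨isOpen_lt differentiable_lamH.continuous continuous_const, fun c hc => ?_, ?_⟩
  · exact (differentiable_lamH.neg c).sqrt (neg_pos.2 hc).ne' |>.differentiableWithinAt
  · intro c hc m
    refine ⟨wedge33 (tri m.1) (hatf (tri c.1)) e6, fun v => ?_, ?_⟩
    · rw [hatf_tri c.2 hc]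
      exact wedge33_tri _ _ v
    · have hd := (hasDerivAt_lamH c.2 m.2).fun_neg.sqrt (by simpa using hc.ne)
      refine hd.congr_deriv ?_
      rw [hatf_tri c.2 hc, wedge33_tri_e6 m.2 (altForms.smul_mem _ (kContract_mem c.2)),
        wedge33_tri_e6 m.2 (kContract_mem c.2)]
      simp only [kCoeff_smul_right, ← Finset.mul_sum, zero_smul, add_zero]
      have h0 : Real.sqrt (-lamH (tri c.1)) ≠ 0 := (Real.sqrt_pos.2 (neg_pos.2 hc)).ne'
      field_simp
end
end

section
/- Long-time existence and convergence of the Type IIA flow on the torus (reduced form): let A : [0, ∞) × ℝ → ℝ^{2×2} be a smooth matrix-valued function, 1-periodic in the space variable x, solving the heat equation ∂_t A(t,x) = 4·∂²_x A(t,x), and such that A(0, x) is a symmetric positive-definite matrix for every x ∈ ℝ. Then A(t, x) is symmetric positive definite for every (t, x) ∈ [0, ∞) × ℝ, and as t → ∞ the functions A(t, ·) converge uniformly on ℝ to the constant matrix Ā := ∫₀¹ A(0, x) dx, which is symmetric positive definite. -/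
open Set Filter Topology

/-- `w` is a jointly continuous solution of `∂ₜw = 4∂ₓ²w` for `t ≥ 0`. -/
def IsHeatSolution (w : ℝ → ℝ → ℝ) : Prop :=
  Continuous (fun p : ℝ × ℝ => w p.1 p.2) ∧
  ∃ wx wxx : ℝ → ℝ → ℝ, ∀ t : ℝ, 0 ≤ t → ∀ x : ℝ,
    HasDerivAt (w t) (wx t x) x ∧ HasDerivAt (wx t) (wxx t x) x ∧
    HasDerivAt (fun s => w s x) (4 * wxx t x) t

namespace IsHeatSolution

variable {v w : ℝ → ℝ → ℝ}

lemma add (hv : IsHeatSolution v) (hw : IsHeatSolution w) :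
    IsHeatSolution fun t x => v t x + w t x := by
  obtain ⟨hvc, vx, vxx, hv⟩ := hv
  obtain ⟨hwc, wx, wxx, hw⟩ := hw
  refine ⟨hvc.add hwc, fun t x => vx t x + wx t x, fun t x => vxx t x + wxx t x,
    fun t ht x => ⟨(hv t ht x).1.add (hw t ht x).1, (hv t ht x).2.1.add (hw t ht x).2.1, ?_⟩⟩
  rw [mul_add]
  exact (hv t ht x).2.2.add (hw t ht x).2.2

lemma const_mul (c : ℝ) (hw : IsHeatSolution w) : IsHeatSolution fun t x => c * w t x := by
  obtain ⟨hwc, wx, wxx, hw⟩ := hw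
  refine ⟨continuous_const.mul hwc, fun t x => c * wx t x, fun t x => c * wxx t x,
    fun t ht x => ⟨(hw t ht x).1.const_mul c, (hw t ht x).2.1.const_mul c, ?_⟩⟩
  rw [mul_left_comm]
  exact (hw t ht x).2.2.const_mul c

lemma neg (hw : IsHeatSolution w) : IsHeatSolution fun t x => -w t x := by
  simpa using hw.const_mul (-1)

lemma sub (hv : IsHeatSolution v) (hw : IsHeatSolution w) :
    IsHeatSolution fun t x => v t x - w t x := by
  simpa [sub_eq_add_neg] using hv.add hw.neg

lemma const (c : ℝ) : IsHeatSolution fun _ _ => c := by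
  refine ⟨continuous_const, fun _ _ => 0, fun _ _ => 0, fun t _ x =>
    ⟨hasDerivAt_const _ _, hasDerivAt_const _ _, ?_⟩⟩
  simpa using hasDerivAt_const t c

lemma comp_const_add (a : ℝ) (hw : IsHeatSolution w) : IsHeatSolution fun t x => w t (a + x) := by
  obtain ⟨hwc, wx, wxx, hw⟩ := hw
  exact ⟨hwc.comp (continuous_fst.prodMk (continuous_const.add continuous_snd)),
    fun t x => wx t (a + x), fun t x => wxx t (a + x), fun t ht x =>
      ⟨(hw t ht (a + x)).1.comp_const_add a x, (hw t ht (a + x)).2.1.comp_const_add a x,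
        (hw t ht (a + x)).2.2⟩⟩

lemma comp_const_sub (a : ℝ) (hw : IsHeatSolution w) : IsHeatSolution fun t x => w t (a - x) := by
  obtain ⟨hwc, wx, wxx, hw⟩ := hw
  refine ⟨hwc.comp (continuous_fst.prodMk (continuous_const.sub continuous_snd)),
    fun t x => -wx t (a - x), fun t x => wxx t (a - x), fun t ht x =>
      ⟨(hw t ht (a - x)).1.comp_const_sub a x, ?_, (hw t ht (a - x)).2.2⟩⟩
  exact (((hw t ht (a - x)).2.1.comp_const_sub a x).fun_neg).congr_deriv (neg_neg _)

lemma exp_mul_cos (k a : ℝ) :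
    IsHeatSolution fun t x => Real.exp (-(4 * k ^ 2) * t) * Real.cos (k * (x - a)) := by
  refine ⟨by fun_prop, fun t x => Real.exp (-(4 * k ^ 2) * t) * (-Real.sin (k * (x - a)) * k),
    fun t x => Real.exp (-(4 * k ^ 2) * t) * (-(Real.cos (k * (x - a)) * k) * k),
    fun t _ x => ⟨?_, ?_, ?_⟩⟩
  · have h : HasDerivAt (fun x => k * (x - a)) k x := by
      simpa using ((hasDerivAt_id x).sub_const a).const_mul k
    exact h.cos.const_mul _
  · have h : HasDerivAt (fun x => k * (x - a)) k x := by
      simpa using ((hasDerivAt_id x).sub_const a).const_mul k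
    exact (h.sin.neg.mul_const k).const_mul _
  · have h : HasDerivAt (fun t => -(4 * k ^ 2) * t) (-(4 * k ^ 2)) t := by
      simpa using (hasDerivAt_id t).const_mul (-(4 * k ^ 2))
    exact (h.exp.mul_const (Real.cos (k * (x - a)))).congr_deriv (by ring)

end IsHeatSolution

/-- The second-derivative necessary condition at a local minimum. -/
lemma IsLocalMin.second_deriv_nonneg {f f' : ℝ → ℝ} {f'' x : ℝ} (hmin : IsLocalMin f x)
    (hf : ∀ y, HasDerivAt f (f' y) y) (hf' : HasDerivAt f' f'' x) : 0 ≤ f'' := by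
  by_contra! hneg
  have hd : deriv f = f' := funext fun y => (hf y).deriv
  have hmax : IsLocalMax f x := by
    refine isLocalMax_of_deriv_deriv_neg ?_ hmin.deriv_eq_zero (hf x).continuousAt
    rwa [hd, hf'.deriv]
  have hconst : f =ᶠ[𝓝 x] fun _ => f x := by
    filter_upwards [hmin, hmax] with y h₁ h₂ using le_antisymm h₂ h₁
  have hzero : f' =ᶠ[𝓝 x] fun _ => 0 := by
    simpa [hd] using hconst.deriv
  have h := hzero.deriv_eq
  rw [hf'.deriv, deriv_const] at h
  exact hneg.ne h

namespace IsHeatSolution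

variable {w : ℝ → ℝ → ℝ}

/-- Weak minimum principle on a compact set `K`: negative minima over `K` are required to be
local minima on the line, as happens for periodic or Dirichlet boundary conditions. -/
lemma nonneg_of_isCompact {K : Set ℝ} (hK : IsCompact K) (hw : IsHeatSolution w)
    (h0 : ∀ x ∈ K, 0 ≤ w 0 x)
    (hmin : ∀ t, 0 ≤ t → ∀ x ∈ K, w t x < 0 → IsMinOn (w t) K x → IsLocalMin (w t) x)
    {t x : ℝ} (ht : 0 ≤ t) (hx : x ∈ K) : 0 ≤ w t x := by
  obtain ⟨hwc, wx, wxx, hw⟩ := hw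
  by_contra! hneg
  set ε := -w t x / (2 * (1 + t)) with hε
  have hεpos : 0 < ε := by
    have : 0 < -w t x := by linarith
    positivity
  have hεt : w t x + ε * t < 0 := by
    have : ε * (2 * (1 + t)) = -w t x := by rw [hε]; field_simp
    nlinarith
  obtain ⟨⟨t₀, x₀⟩, ⟨ht₀, hx₀⟩, hm⟩ := (isCompact_Icc (a := (0 : ℝ)) (b := t)).prod hK
    |>.exists_isMinOn ⟨(t, x), ⟨ht, le_rfl⟩, hx⟩
      (f := fun p : ℝ × ℝ => w p.1 p.2 + ε * p.1) (by fun_prop)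
  have hm' : ∀ s ∈ Icc 0 t, ∀ y ∈ K, w t₀ x₀ + ε * t₀ ≤ w s y + ε * s :=
    fun s hs y hy => hm (show (s, y) ∈ Icc 0 t ×ˢ K from ⟨hs, hy⟩)
  have hnn : 0 ≤ t₀ := ht₀.1
  have hlt : w t₀ x₀ + ε * t₀ < 0 := (hm' t ⟨ht, le_rfl⟩ x hx).trans_lt hεt
  have hneg₀ : w t₀ x₀ < 0 := by nlinarith [mul_nonneg hεpos.le hnn]
  have hpos₀ : 0 < t₀ := by
    refine hnn.lt_of_ne fun h => ?_
    rw [← h] at hneg₀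
    exact (h0 x₀ hx₀).not_gt hneg₀
  have hloc := hmin t₀ hnn x₀ hx₀ hneg₀ fun y hy => by
    simpa using hm' t₀ ht₀ y hy
  have hxx := hloc.second_deriv_nonneg (fun y => (hw t₀ hnn y).1) (hw t₀ hnn x₀).2.1
  have hd : HasDerivAt (fun s => w s x₀ + ε * s) (4 * wxx t₀ x₀ + ε) t₀ := by
    simpa using (hw t₀ hnn x₀).2.2.fun_add ((hasDerivAt_id t₀).const_mul ε)
  have hslope := hd.hasDerivWithinAt (s := Iio t₀)
  rw [hasDerivWithinAt_iff_tendsto_slope' (by simp)] at hslope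
  have hle : 4 * wxx t₀ x₀ + ε ≤ 0 := by
    refine le_of_tendsto hslope ?_
    filter_upwards [Ioo_mem_nhdsLT hpos₀] with s hs
    rw [slope_def_field]
    exact div_nonpos_of_nonneg_of_nonpos
      (sub_nonneg.2 (hm' s ⟨hs.1.le, hs.2.le.trans ht₀.2⟩ x₀ hx₀)) (by linarith [hs.2])
  linarith

lemma nonneg_of_periodic (hw : IsHeatSolution w) (hper : ∀ t, Function.Periodic (w t) 1)
    (h0 : ∀ x, 0 ≤ w 0 x) {t : ℝ} (ht : 0 ≤ t) (x : ℝ) : 0 ≤ w t x := by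
  have key : ∀ s, 0 ≤ s → ∀ y ∈ Icc (0 : ℝ) 1, 0 ≤ w s y := fun s hs y hy =>
    hw.nonneg_of_isCompact isCompact_Icc (fun y _ => h0 y)
      (fun r _ z _ _ hm => Eventually.of_forall fun u => by
        obtain ⟨u', hu', h⟩ := (hper r).exists_mem_Ico₀ one_pos u
        rw [h]
        exact hm (Ico_subset_Icc_self hu')) hs hy
  obtain ⟨y, hy, h⟩ := (hper t).exists_mem_Ico₀ one_pos x
  rw [h]
  exact key t ht y (Ico_subset_Icc_self hy)

lemma nonneg_of_boundary {a b : ℝ} (hw : IsHeatSolution w)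
    (h0 : ∀ x ∈ Icc a b, 0 ≤ w 0 x) (ha : ∀ t, 0 ≤ t → 0 ≤ w t a) (hb : ∀ t, 0 ≤ t → 0 ≤ w t b)
    {t x : ℝ} (ht : 0 ≤ t) (hx : x ∈ Icc a b) : 0 ≤ w t x := by
  refine hw.nonneg_of_isCompact isCompact_Icc h0 (fun s hs y hy hneg hm => ?_) ht hx
  refine hm.isLocalMin (Icc_mem_nhds (hy.1.lt_of_ne ?_) (hy.2.lt_of_ne ?_))
  · rintro rfl
    exact (ha s hs).not_gt hneg
  · rintro rfl
    exact (hb s hs).not_gt hneg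

lemma pos_of_periodic (hw : IsHeatSolution w) (hper : ∀ t, Function.Periodic (w t) 1)
    (h0 : ∀ x, 0 < w 0 x) {t : ℝ} (ht : 0 ≤ t) (x : ℝ) : 0 < w t x := by
  have hc : Continuous (w 0) := hw.1.comp (Continuous.prodMk_right 0)
  obtain ⟨z, -, hz⟩ := isCompact_Icc.exists_isMinOn (nonempty_Icc.2 (zero_le_one' ℝ)) hc.continuousOn
  have h := (hw.sub (const (w 0 z))).nonneg_of_periodic (fun s y => by simp [hper s y])
    (fun y => by
      obtain ⟨y', hy', h⟩ := (hper 0).exists_mem_Ico₀ one_pos y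
      rw [h]
      exact sub_nonneg.2 (hz (Ico_subset_Icc_self hy'))) ht x
  linarith [h0 z]

/-- Oscillation decay, by comparing the odd part of `w` about each point with the barrier
`e^{-4π²t} cos (π (x - 1/4))` on half a period. -/
lemma sub_le_exp (hw : IsHeatSolution w) (hper : ∀ t, Function.Periodic (w t) 1) {M : ℝ}
    (hM : ∀ x, |w 0 x| ≤ M) {t : ℝ} (ht : 0 ≤ t) {x y : ℝ} (hxy : y ∈ Icc (x - 1) x) :
    w t x - w t y ≤ 4 * M * Real.exp (-(4 * Real.pi ^ 2) * t) := by
  have hM0 : 0 ≤ M := (abs_nonneg _).trans (hM 0)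
  have hcos : ∀ h ∈ Icc (0 : ℝ) (1 / 2), 1 / 2 ≤ Real.cos (Real.pi * (h - 1 / 4)) := by
    intro h hh
    rw [← Real.cos_pi_div_three, ← Real.cos_abs (Real.pi * (h - 1 / 4))]
    have : |h - 1 / 4| ≤ 1 / 4 := abs_le.2 ⟨by linarith [hh.1], by linarith [hh.2]⟩
    refine Real.cos_le_cos_of_nonneg_of_le_pi (abs_nonneg _) (by linarith [Real.pi_pos]) ?_
    rw [abs_mul, abs_of_pos Real.pi_pos]
    nlinarith [Real.pi_pos]
  set c := (x + y) / 2 with hc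
  have hb : ∀ s, ∀ h ∈ Icc (0 : ℝ) (1 / 2), 0 ≤ 4 * M *
      (Real.exp (-(4 * Real.pi ^ 2) * s) * Real.cos (Real.pi * (h - 1 / 4))) := fun s h hh => by
    have := (hcos h hh).trans' (by norm_num : (0 : ℝ) ≤ 1 / 2)
    positivity
  have hsol := ((exp_mul_cos Real.pi (1 / 4)).const_mul (4 * M)).sub
    ((hw.comp_const_add c).sub (hw.comp_const_sub c))
  have hh : (x - y) / 2 ∈ Icc (0 : ℝ) (1 / 2) :=
    ⟨by linarith [hxy.2], by linarith [hxy.1]⟩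
  have key := hsol.nonneg_of_boundary (a := 0) (b := 1 / 2) (fun h hh => ?_) (fun s _ => ?_)
    (fun s _ => ?_) ht hh
  · rw [show c + (x - y) / 2 = x by rw [hc]; ring, show c - (x - y) / 2 = y by rw [hc]; ring] at key
    have h1 : 4 * M * (Real.exp (-(4 * Real.pi ^ 2) * t) *
        Real.cos (Real.pi * ((x - y) / 2 - 1 / 4))) ≤
        4 * M * (Real.exp (-(4 * Real.pi ^ 2) * t) * 1) := by
      gcongr
      exact Real.cos_le_one _
    linarith
  · have h1 := abs_le.1 (hM (c + h))
    have h2 := abs_le.1 (hM (c - h))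
    have h3 := mul_le_mul_of_nonneg_left (hcos h hh) (by positivity : 0 ≤ 4 * M)
    simp only [mul_zero, Real.exp_zero, one_mul]
    linarith [h1.2, h2.1]
  · simpa using hb s 0 ⟨le_rfl, by norm_num⟩
  · have h1 : w s (c + 1 / 2) = w s (c - 1 / 2) := by
      rw [← hper s (c - 1 / 2)]
      congr 1
      ring
    rw [h1, sub_self, sub_zero]
    exact hb s (1 / 2) ⟨by norm_num, le_rfl⟩

lemma abs_sub_integral_le (hw : IsHeatSolution w) (hper : ∀ t, Function.Periodic (w t) 1) {M : ℝ}
    (hM : ∀ x, |w 0 x| ≤ M) {t : ℝ} (ht : 0 ≤ t) (x : ℝ) :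
    |w t x - ∫ y in (0 : ℝ)..1, w t y| ≤ 4 * M * Real.exp (-(4 * Real.pi ^ 2) * t) := by
  have hc : Continuous (w t) := hw.1.comp (Continuous.prodMk_right t)
  have hI : w t x - ∫ y in (0 : ℝ)..1, w t y = ∫ y in (x - 1)..x, (w t x - w t y) := by
    rw [intervalIntegral.integral_sub intervalIntegrable_const (hc.intervalIntegrable _ _)]
    have := (hper t).intervalIntegral_add_eq (x - 1) 0
    rw [sub_add_cancel, zero_add] at this
    simp [this]
  rw [hI, ← Real.norm_eq_abs]
  refine (intervalIntegral.norm_integral_le_of_norm_le_const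
    (C := 4 * M * Real.exp (-(4 * Real.pi ^ 2) * t)) fun y hy => ?_).trans_eq (by simp)
  rw [uIoc_of_le (by linarith)] at hy
  have hy' := Ioc_subset_Icc_self hy
  have h1 := hw.sub_le_exp hper hM ht hy'
  have h2 := hw.neg.sub_le_exp (fun s z => by simp [hper s z]) (by simpa using hM) ht hy'
  exact abs_le.2 ⟨by linarith, h1⟩

/-- Conservation of the mean. -/
lemma integral_eq (hw : IsHeatSolution w) (hper : ∀ t, Function.Periodic (w t) 1)
    (hC : ContDiff ℝ 1 fun p : ℝ × ℝ => w p.1 p.2) {t : ℝ} (ht : 0 ≤ t) :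
    ∫ x in (0 : ℝ)..1, w t x = ∫ x in (0 : ℝ)..1, w 0 x := by
  obtain ⟨hwc, wx, wxx, hw⟩ := hw
  have hcx : ∀ s, Continuous (w s) := fun s => hwc.comp (Continuous.prodMk_right s)
  set wt : ℝ × ℝ → ℝ := fun p => fderiv ℝ (fun p : ℝ × ℝ => w p.1 p.2) p (1, 0) with hwt
  have hwtc : Continuous wt := (hC.continuous_fderiv one_ne_zero).clm_apply continuous_const
  have hwtd : ∀ s x, HasDerivAt (fun r => w r x) (wt (s, x)) s := fun s x =>
    HasFDerivAt.comp_hasDerivAt (f := fun r : ℝ => (r, x)) s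
      (hC.differentiable one_ne_zero (s, x)).hasFDerivAt
      ((hasDerivAt_id s).prodMk (hasDerivAt_const s x))
  have hderiv : ∀ s, 0 ≤ s → HasDerivAt (fun r => ∫ x in (0 : ℝ)..1, w r x) 0 s := by
    intro s hs
    obtain ⟨B, hB⟩ := ((isCompact_Icc (a := s - 1) (b := s + 1)).prod
      (isCompact_Icc (a := (0 : ℝ)) (b := 1))).exists_bound_of_continuousOn hwtc.continuousOn
    have h := (intervalIntegral.hasDerivAt_integral_of_dominated_loc_of_deriv_le
      (μ := MeasureTheory.volume) (a := 0) (b := 1)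
      (F := w) (F' := fun r x => wt (r, x)) (bound := fun _ => B)
      (Icc_mem_nhds (by linarith : s - 1 < s) (by linarith : s < s + 1))
      (Eventually.of_forall fun r => (hcx r).aestronglyMeasurable)
      ((hcx s).intervalIntegrable _ _)
      (hwtc.comp (Continuous.prodMk_right s)).aestronglyMeasurable
      (Eventually.of_forall fun x hx r hr => hB (r, x) ⟨hr, by
        rw [uIoc_of_le zero_le_one] at hx
        exact Ioc_subset_Icc_self hx⟩)
      intervalIntegrable_const
      (Eventually.of_forall fun x _ r _ => hwtd r x)).2
    have heq : ∀ x, 4 * wxx s x = wt (s, x) := fun x => (hw s hs x).2.2.unique (hwtd s x)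
    have hzero : ∫ x in (0 : ℝ)..1, wt (s, x) = 0 := by
      rw [intervalIntegral.integral_eq_sub_of_hasDerivAt (f := fun x => 4 * wx s x)
        (fun x _ => ((hw s hs x).2.1.const_mul 4).congr_deriv (heq x))
        ((hwtc.comp (Continuous.prodMk_right s)).intervalIntegrable _ _)]
      have h01 : wx s 1 = wx s 0 := by
        have h1 := (hw s hs (0 + 1)).1.comp_add_const 0 1
        rw [funext (hper s)] at h1
        simpa using h1.unique (hw s hs 0).1
      rw [h01, sub_self]
    rwa [hzero] at h
  exact constant_of_has_deriv_right_zero (a := 0) (b := t)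
    (fun s hs => (hderiv s hs.1).continuousAt.continuousWithinAt)
    (fun s hs => (hderiv s hs.1).hasDerivWithinAt) t ⟨ht, le_rfl⟩

lemma tendstoUniformly (hw : IsHeatSolution w) (hper : ∀ t, Function.Periodic (w t) 1)
    (hC : ContDiff ℝ 1 fun p : ℝ × ℝ => w p.1 p.2) :
    TendstoUniformly w (fun _ => ∫ x in (0 : ℝ)..1, w 0 x) atTop := by
  have hc : Continuous (w 0) := hw.1.comp (Continuous.prodMk_right 0)
  obtain ⟨M, hM⟩ := isCompact_Icc.exists_bound_of_continuousOn (s := Icc (0 : ℝ) 1) hc.continuousOn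
  have hM' : ∀ x, |w 0 x| ≤ M := fun x => by
    obtain ⟨y, hy, h⟩ := (hper 0).exists_mem_Ico₀ one_pos x
    rw [h]
    exact hM y (Ico_subset_Icc_self hy)
  have hlim : Tendsto (fun t => 4 * M * Real.exp (-(4 * Real.pi ^ 2) * t)) atTop (𝓝 0) := by
    have h : Tendsto (fun t : ℝ => -(4 * Real.pi ^ 2) * t) atTop atBot :=
      tendsto_id.const_mul_atTop_of_neg (by have := Real.pi_pos; simp only [neg_lt_zero]; positivity)
    simpa using (Real.tendsto_exp_atBot.comp h).const_mul (4 * M)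
  rw [Metric.tendstoUniformly_iff]
  intro ε hε
  filter_upwards [hlim.eventually_lt_const hε, eventually_ge_atTop 0] with t hlt ht x
  rw [dist_comm, Real.dist_eq, ← hw.integral_eq hper hC ht]
  exact (hw.abs_sub_integral_le hper hM' ht x).trans_lt hlt

lemma of_contDiff (hC : ContDiff ℝ 2 fun p : ℝ × ℝ => w p.1 p.2)
    (hheat : ∀ t : ℝ, 0 ≤ t → ∀ x : ℝ,
      HasDerivAt (fun s => w s x) (4 * deriv (fun y => deriv (fun z => w t z) y) x) t) :
    IsHeatSolution w := by
  refine ⟨hC.continuous, fun t => deriv (w t), fun t => deriv (deriv (w t)), fun t ht x => ?_⟩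
  have h2 : ContDiff ℝ 2 (w t) := hC.comp (contDiff_const.prodMk contDiff_id)
  have h1 : ContDiff ℝ 1 (deriv (w t)) := h2.deriv' (n := 1)
  exact ⟨(h2.differentiable two_ne_zero x).hasDerivAt,
    (h1.differentiable one_ne_zero x).hasDerivAt, hheat t ht x⟩

end IsHeatSolution

lemma Matrix.posDef_of_isSymm_fin_two {M : Matrix (Fin 2) (Fin 2) ℝ} (hM : M.IsSymm)
    (h : ∀ v : Fin 2 → ℝ, v ≠ 0 → 0 < ∑ i, ∑ j, v i * v j * M i j) : M.PosDef := by
  refine Matrix.posDef_iff_dotProduct_mulVec.2 ⟨?_, fun v hv => ?_⟩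
  · rwa [Matrix.IsHermitian, Matrix.conjTranspose_eq_transpose_of_trivial]
  · refine (h v hv).trans_eq ?_
    simp only [dotProduct, Matrix.mulVec, Fin.sum_univ_two, Pi.star_apply, star_trivial]
    ring

lemma Matrix.PosDef.sum_fin_two_pos {M : Matrix (Fin 2) (Fin 2) ℝ} (hM : M.PosDef)
    {v : Fin 2 → ℝ} (hv : v ≠ 0) : 0 < ∑ i, ∑ j, v i * v j * M i j := by
  refine (hM.dotProduct_mulVec_pos hv).trans_eq ?_
  simp only [dotProduct, Matrix.mulVec, Fin.sum_univ_two, Pi.star_apply, star_trivial]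
  ring


/-- Long-time existence and convergence of the Type IIA flow on the torus
(reduced form): a smooth 1-periodic-in-space solution `A(t,x)` of the heat equation
`∂ₜA = 4∂ₓ²A` with symmetric positive-definite initial matrix stays symmetric positive
definite, and converges uniformly as `t → ∞` to the (symmetric positive-definite) mean
`Ā = ∫₀¹ A(0,x) dx` of its initial value. -/
theorem torus_heat_flow_convergence (A : ℝ → ℝ → Fin 2 → Fin 2 → ℝ)
    (hsmooth : ∀ i j : Fin 2, ContDiff ℝ (⊤ : ℕ∞) fun p : ℝ × ℝ => A p.1 p.2 i j)
    (hper : ∀ t x : ℝ, A t (x + 1) = A t x)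
    (hheat : ∀ t : ℝ, 0 ≤ t → ∀ x : ℝ, ∀ i j : Fin 2,
      HasDerivAt (fun s : ℝ => A s x i j)
        (4 * deriv (fun y : ℝ => deriv (fun z : ℝ => A t z i j) y) x) t)
    (hinit : ∀ x : ℝ, (Matrix.of (A 0 x)).IsSymm ∧ (Matrix.of (A 0 x)).PosDef) :
    (∀ t : ℝ, 0 ≤ t → ∀ x : ℝ, (Matrix.of (A t x)).IsSymm ∧ (Matrix.of (A t x)).PosDef) ∧
    (Matrix.of fun i j => ∫ x in (0 : ℝ)..1, A 0 x i j).IsSymm ∧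
    (Matrix.of fun i j => ∫ x in (0 : ℝ)..1, A 0 x i j).PosDef ∧
    TendstoUniformly (fun t : ℝ => fun x : ℝ => A t x)
      (fun _ : ℝ => fun i j => ∫ x in (0 : ℝ)..1, A 0 x i j) Filter.atTop := by
  have hsol : ∀ i j, IsHeatSolution fun t x => A t x i j := fun i j =>
    .of_contDiff ((hsmooth i j).of_le (WithTop.coe_le_coe.2 le_top))
      (fun t ht x => hheat t ht x i j)
  have hp : ∀ i j t, Function.Periodic (fun x => A t x i j) 1 := fun i j t x => by
    simp only [hper t x]
  have hc0 : ∀ i j, Continuous fun x => A 0 x i j := fun i j =>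
    (hsol i j).1.comp (Continuous.prodMk_right 0)
  have hsymm0 : ∀ x i j, A 0 x i j = A 0 x j i := fun x i j => (hinit x).1.apply j i
  have hsymm : ∀ t, 0 ≤ t → ∀ x, (Matrix.of (A t x)).IsSymm := fun t ht x => by
    have hle : ∀ i j, A t x i j ≤ A t x j i := fun i j => sub_nonneg.1 <|
      ((hsol j i).sub (hsol i j)).nonneg_of_periodic
        (fun s y => by simp only [hper s y]) (fun y => by rw [hsymm0 y i j, sub_self]) ht x
    exact Matrix.IsSymm.ext fun i j => le_antisymm (hle j i) (hle i j)
  have hsymmI : (Matrix.of fun i j => ∫ x in (0 : ℝ)..1, A 0 x i j).IsSymm :=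
    Matrix.IsSymm.ext fun i j => by simp only [Matrix.of_apply, hsymm0 _ j i]
  refine ⟨fun t ht x => ⟨hsymm t ht x, Matrix.posDef_of_isSymm_fin_two (hsymm t ht x)
    fun v hv => ?_⟩, hsymmI, Matrix.posDef_of_isSymm_fin_two hsymmI fun v hv => ?_, ?_⟩
  · have hq : IsHeatSolution fun t x => ∑ i, ∑ j, v i * v j * A t x i j := by
      simp only [Fin.sum_univ_two]
      exact (((hsol 0 0).const_mul _).add ((hsol 0 1).const_mul _)).add
        (((hsol 1 0).const_mul _).add ((hsol 1 1).const_mul _))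
    exact hq.pos_of_periodic (fun s y => by simp only [hper s y])
      (fun y => (hinit y).2.sum_fin_two_pos hv) ht x
  · have hI : ∑ i, ∑ j, v i * v j * ∫ x in (0 : ℝ)..1, A 0 x i j =
        ∫ x in (0 : ℝ)..1, ∑ i, ∑ j, v i * v j * A 0 x i j := by
      have hint : ∀ i j, IntervalIntegrable (fun x => v i * v j * A 0 x i j)
          MeasureTheory.volume 0 1 := fun i j =>
        (continuous_const.mul (hc0 i j)).intervalIntegrable _ _
      simp only [Fin.sum_univ_two]
      rw [intervalIntegral.integral_add ((hint 0 0).add (hint 0 1)) ((hint 1 0).add (hint 1 1)),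
        intervalIntegral.integral_add (hint 0 0) (hint 0 1),
        intervalIntegral.integral_add (hint 1 0) (hint 1 1)]
      simp only [intervalIntegral.integral_const_mul]
    simp only [Matrix.of_apply]
    rw [hI]
    refine intervalIntegral.intervalIntegral_pos_of_pos
      (Continuous.intervalIntegrable ?_ _ _) (fun x => (hinit x).2.sum_fin_two_pos hv) one_pos
    exact continuous_finsetSum _ fun i _ => continuous_finsetSum _ fun j _ =>
      continuous_const.mul (hc0 i j)
  · have h : ∀ i j, TendstoUniformly (fun t x => A t x i j)
        (fun _ => ∫ x in (0 : ℝ)..1, A 0 x i j) atTop := fun i j =>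
      (hsol i j).tendstoUniformly (hp i j) ((hsmooth i j).of_le (WithTop.coe_le_coe.2 le_top))
    simp only [Metric.tendstoUniformly_iff] at h ⊢
    intro ε hε
    have hall : ∀ᶠ t in atTop, ∀ i j, ∀ x,
        dist (∫ x in (0 : ℝ)..1, A 0 x i j) (A t x i j) < ε :=
      eventually_all.2 fun i => eventually_all.2 fun j => h i j ε hε
    filter_upwards [hall] with t ht x
    exact (dist_pi_lt_iff hε).2 fun i => (dist_pi_lt_iff hε).2 fun j => ht i j x
end
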